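/- arXiv:2207.06125 — 2 statements merged into one kernel-verified Lean document; each statement's English description precedes it below -/
import Mathlib

section
/- There exists σ_r > 0 such that: for every σ > σ_r the equation u_t = (a(u,u_x))_x + f(u) admits a classic traveling wave moving at speed σ, and for every σ with 0 ≤ σ < σ_r there is no classic traveling wave moving at speed σ. -/
open Set Filter Topology
open scoped ENNReal

noncomputable section

/-- The strip `Ω` between `-ω` and `ω` over `[0,1]`:
`Ω = {(u,s) : u ∈ [0,1], -ω(u) < s < ω(u)}`. -/
def OmegaSet (ω : ℝ → ℝ≥0∞) : Set (ℝ × ℝ) :=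
  {p | p.1 ∈ Set.Icc (0:ℝ) 1 ∧ ENNReal.ofReal |p.2| < ω p.1}

/-- The set `𝒟` between `a₋ = -a₊` and `a₊` over `[0,1]`. -/
def DSet (aplus : ℝ → ℝ≥0∞) : Set (ℝ × ℝ) :=
  {p | p.1 ∈ Set.Icc (0:ℝ) 1 ∧ ENNReal.ofReal |p.2| < aplus p.1}

/-- Standing data and hypotheses: a lower semicontinuous width `ω : [0,1] → (0,∞]`,
a regular flux `a` on `Ω` (odd in `s`, C¹, with `∂a/∂s > 0`), the maximal fluxes
`a₊(u) = lim_{s→ω(u)⁻} a(u,s)` (equivalently, the supremum over `0 < s < ω(u)`),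
which are `+∞` whenever `ω(u) < ∞`, the partial inverse `g` on `𝒟` defined by
`a(u, g(u,v)) = v`, and a logistic-type reaction term `f`. -/
structure FluxData where
  ω : ℝ → ℝ≥0∞
  a : ℝ → ℝ → ℝ
  aplus : ℝ → ℝ≥0∞
  g : ℝ → ℝ → ℝ
  f : ℝ → ℝ
  ω_pos : ∀ u ∈ Set.Icc (0:ℝ) 1, 0 < ω u
  ω_lsc : LowerSemicontinuousOn ω (Set.Icc (0:ℝ) 1)
  a_odd : ∀ u s, (u, s) ∈ OmegaSet ω → a u (-s) = - a u s
  a_C1 : ContDiffOn ℝ 1 (fun p : ℝ × ℝ => a p.1 p.2) (OmegaSet ω)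
  a_deriv_pos : ∀ u s, (u, s) ∈ OmegaSet ω → ∃ d : ℝ, 0 < d ∧ HasDerivAt (a u) d s
  aplus_def : ∀ u ∈ Set.Icc (0:ℝ) 1,
      aplus u = ⨆ s ∈ {s : ℝ | 0 < s ∧ (u, s) ∈ OmegaSet ω}, ENNReal.ofReal (a u s)
  aplus_pos : ∀ u ∈ Set.Icc (0:ℝ) 1, 0 < aplus u
  aplus_top : ∀ u ∈ Set.Icc (0:ℝ) 1, ω u < ⊤ → aplus u = ⊤
  g_spec : ∀ p ∈ DSet aplus, (p.1, g p.1 p.2) ∈ OmegaSet ω ∧ a p.1 (g p.1 p.2) = p.2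
  f_C1 : ContDiffOn ℝ 1 f (Set.Icc (0:ℝ) 1)
  f_zero : f 0 = 0
  f_one : f 1 = 0
  f_pos : ∀ u ∈ Set.Ioo (0:ℝ) 1, 0 < f u

/-- A classic traveling wave of `u_t = (b(u,u_x))_x + f(u)` moving at speed `σ`:
a C² increasing profile `u` with values in `(0,1)`, `0 < u' < ω(u)`, connecting
`0` at `-∞` to `1` at `+∞`, such that `ξ ↦ b(u(ξ),u'(ξ))` is differentiable and
`(b(u,u'))' - σ u' + f(u) = 0`. -/
def IsClassicTW (F : FluxData) (b : ℝ → ℝ → ℝ) (σ : ℝ) (u : ℝ → ℝ) : Prop :=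
  ContDiff ℝ 2 u ∧
  (∀ ξ : ℝ, u ξ ∈ Set.Ioo (0:ℝ) 1) ∧
  (∀ ξ : ℝ, 0 < deriv u ξ ∧ ENNReal.ofReal (deriv u ξ) < F.ω (u ξ)) ∧
  Filter.Tendsto u Filter.atBot (nhds 0) ∧
  Filter.Tendsto u Filter.atTop (nhds 1) ∧
  (∀ ξ : ℝ, HasDerivAt (fun t => b (u t) (deriv u t)) (σ * deriv u ξ - F.f (u ξ)) ξ)

/-- A right solution with speed `σ`: `V : (α,1] → ℝ`, continuous on `(α,1]`,
C¹ on `(α,1)`, `V(1) = 0`, and on `(α,1)` : `V > 0`, `(u,V(u)) ∈ 𝒟` and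
`V' = σ - f(u)/g(u,V(u))`. -/
def IsRightSolution (F : FluxData) (σ α : ℝ) (V : ℝ → ℝ) : Prop :=
  α ∈ Set.Ico (0:ℝ) 1 ∧
  ContinuousOn V (Set.Ioc α 1) ∧
  V 1 = 0 ∧
  ∀ u ∈ Set.Ioo α 1, 0 < V u ∧ (u, V u) ∈ DSet F.aplus ∧
    HasDerivAt V (σ - F.f u / F.g u (V u)) u

open Classical in
/-- `ℋ(u,V) = 1/g(u,V)` if `0 < V < a₊(u)`, and `0` if `V ≥ a₊(u)`. -/
def Hfun (F : FluxData) (u V : ℝ) : ℝ :=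
  if ENNReal.ofReal V < F.aplus u then 1 / F.g u V else 0

/-- The solution `𝒱_σ` of the extended problem: continuous on `[0,1]`, C¹ on `(0,1)`,
`𝒱(1) = 0`, `𝒱 > 0` on `(0,1)` and `𝒱' = σ - f(u)·ℋ(u,𝒱(u))` on `(0,1)`. -/
def IsVsol (F : FluxData) (σ : ℝ) (V : ℝ → ℝ) : Prop :=
  ContinuousOn V (Set.Icc (0:ℝ) 1) ∧ V 1 = 0 ∧
  (∀ u ∈ Set.Ioo (0:ℝ) 1, 0 < V u) ∧
  (∀ u ∈ Set.Ioo (0:ℝ) 1, HasDerivAt V (σ - F.f u * Hfun F u (V u)) u)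

/-- The slopes `s` admissible over `u`, i.e. the section of `Ω` at `u`. -/
def slopes (F : FluxData) (u : ℝ) : Set ℝ := {s | (u, s) ∈ OmegaSet F.ω}

/-- The inverse of `a u` on the section of `Ω` at `u`. -/
def slopeOf (F : FluxData) (u v : ℝ) : ℝ := Function.invFunOn (F.a u) (slopes F u) v

/-- The pairs `(u, a(u,s))` with `0 < u < 1`, `0 < s < ω(u)`. -/
def fluxRegion (F : FluxData) : Set (ℝ × ℝ) :=
  {p | p.1 ∈ Ioo (0:ℝ) 1 ∧ ∃ s, 0 < s ∧ s ∈ slopes F p.1 ∧ F.a p.1 s = p.2}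

lemma slopes_of_abs_le {F : FluxData} {u s t : ℝ} (h : |t| ≤ |s|) (hs : s ∈ slopes F u) :
    t ∈ slopes F u :=
  ⟨hs.1, (ENNReal.ofReal_le_ofReal h).trans_lt hs.2⟩

lemma ordConnected_slopes (F : FluxData) (u : ℝ) : (slopes F u).OrdConnected := by
  refine ⟨fun x hx y hy z hz => ?_⟩
  rcases le_total |x| |y| with h | h
  · exact slopes_of_abs_le ((abs_le_max_abs_abs hz.1 hz.2).trans (max_le h le_rfl)) hy
  · exact slopes_of_abs_le ((abs_le_max_abs_abs hz.1 hz.2).trans (max_le le_rfl h)) hx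

lemma zero_mem_slopes (F : FluxData) {u : ℝ} (hu : u ∈ Icc (0:ℝ) 1) : (0:ℝ) ∈ slopes F u :=
  ⟨hu, by simpa using F.ω_pos u hu⟩

lemma flux_zero (F : FluxData) {u : ℝ} (hu : u ∈ Icc (0:ℝ) 1) : F.a u 0 = 0 := by
  have := F.a_odd u 0 (zero_mem_slopes F hu)
  simp only [neg_zero] at this
  linarith

lemma continuousOn_flux (F : FluxData) (u : ℝ) : ContinuousOn (F.a u) (slopes F u) := by
  intro s hs
  obtain ⟨d, -, hd⟩ := F.a_deriv_pos u s hs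
  exact hd.continuousAt.continuousWithinAt

lemma strictMonoOn_flux (F : FluxData) (u : ℝ) : StrictMonoOn (F.a u) (slopes F u) := by
  refine strictMonoOn_of_deriv_pos (ordConnected_slopes F u).convex (continuousOn_flux F u) ?_
  intro s hs
  obtain ⟨d, h, hd⟩ := F.a_deriv_pos u s (interior_subset hs : s ∈ slopes F u)
  rwa [hd.deriv]

lemma slopeOf_flux {F : FluxData} {u s : ℝ} (hs : s ∈ slopes F u) :
    slopeOf F u (F.a u s) = s :=
  (strictMonoOn_flux F u).injOn.leftInvOn_invFunOn hs

lemma flux_pos {F : FluxData} {u s : ℝ} (hs : s ∈ slopes F u) (h : 0 < s) : 0 < F.a u s := by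
  have := strictMonoOn_flux F u (zero_mem_slopes F hs.1) hs h
  rwa [flux_zero F hs.1] at this

lemma slopeOf_spec {F : FluxData} {p : ℝ × ℝ} (hp : p ∈ fluxRegion F) :
    0 < slopeOf F p.1 p.2 ∧ slopeOf F p.1 p.2 ∈ slopes F p.1 ∧
      F.a p.1 (slopeOf F p.1 p.2) = p.2 := by
  obtain ⟨-, s, h, hs, e⟩ := hp
  rw [← e, slopeOf_flux hs]
  exact ⟨h, hs, rfl⟩

lemma fluxRegion_snd_pos {F : FluxData} {p : ℝ × ℝ} (hp : p ∈ fluxRegion F) : 0 < p.2 := by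
  obtain ⟨h, hs, e⟩ := slopeOf_spec hp
  exact e ▸ flux_pos hs h

/-- The region is stable under decreasing the flux. -/
lemma fluxRegion_of_le {F : FluxData} {u v w : ℝ} (hw : (u, w) ∈ fluxRegion F) (hv : 0 < v)
    (hvw : v ≤ w) : (u, v) ∈ fluxRegion F := by
  obtain ⟨hu, s, h, hs, e⟩ := hw
  simp only at e hs hu
  have hsub : Icc 0 s ⊆ slopes F u :=
    (ordConnected_slopes F u).out (zero_mem_slopes F (Ioo_subset_Icc_self hu)) hs
  have := intermediate_value_Icc h.le ((continuousOn_flux F u).mono hsub)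
  rw [flux_zero F (Ioo_subset_Icc_self hu), e] at this
  obtain ⟨t, ht, hte⟩ := this ⟨hv.le, hvw⟩
  refine ⟨hu, t, ht.1.lt_of_ne ?_, hsub ht, hte⟩
  rintro rfl
  rw [flux_zero F (Ioo_subset_Icc_self hu)] at hte
  exact hv.ne hte

lemma OmegaSet_mem_nhds {F : FluxData} {p : ℝ × ℝ} (hp : p ∈ OmegaSet F.ω)
    (hu : p.1 ∈ Ioo (0:ℝ) 1) : OmegaSet F.ω ∈ 𝓝 p := by
  obtain ⟨r, hr1, hr2⟩ := exists_between hp.2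
  have h1 := F.ω_lsc p.1 hp.1 r hr2
  rw [nhdsWithin_eq_nhds.2 (Icc_mem_nhds hu.1 hu.2)] at h1
  have h2 : ∀ᶠ q : ℝ × ℝ in 𝓝 p, r < F.ω q.1 := continuousAt_fst.eventually h1
  have h3 : ∀ᶠ q : ℝ × ℝ in 𝓝 p, ENNReal.ofReal |q.2| < r := by
    have : ContinuousAt (fun q : ℝ × ℝ => ENNReal.ofReal |q.2|) p :=
      (ENNReal.continuous_ofReal.comp (continuous_abs.comp continuous_snd)).continuousAt
    exact this.eventually (gt_mem_nhds hr1)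
  have h4 : ∀ᶠ q : ℝ × ℝ in 𝓝 p, q.1 ∈ Icc (0:ℝ) 1 :=
    continuousAt_fst.eventually (Icc_mem_nhds hu.1 hu.2)
  filter_upwards [h2, h3, h4] with q a b c using ⟨c, b.trans a⟩

/-- `a` is locally `C¹` invertible in the slope, at interior values of `u`. -/
lemma fluxRegion_nhds_and_contDiffAt {F : FluxData} {p : ℝ × ℝ} (hp : p ∈ fluxRegion F) :
    fluxRegion F ∈ 𝓝 p ∧ ContDiffAt ℝ 1 (fun q : ℝ × ℝ => slopeOf F q.1 q.2) p := by
  obtain ⟨u, v⟩ := p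
  obtain ⟨hu, s, h, hs, e⟩ := hp
  simp only at hu hs e
  subst e
  have hΩ := OmegaSet_mem_nhds (p := (u, s)) hs hu
  have ha : ContDiffAt ℝ 1 (fun p : ℝ × ℝ => F.a p.1 p.2) (u, s) := F.a_C1.contDiffAt hΩ
  let Φ : ℝ × ℝ → ℝ × ℝ := fun q => (q.1, F.a q.1 q.2)
  have hΦ : ContDiffAt ℝ 1 Φ (u, s) := contDiffAt_fst.prodMk ha
  obtain ⟨A, hA⟩ := ha.differentiableAt (by simp)
  obtain ⟨d, hd0, hd⟩ := F.a_deriv_pos u s hs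
  have hA1 : A (0, 1) = d := by
    have h1 : HasDerivAt (fun t : ℝ => (u, t)) ((0:ℝ), (1:ℝ)) s :=
      (hasDerivAt_const s u).prodMk (hasDerivAt_id s)
    exact (HasFDerivAt.comp_hasDerivAt s (f := fun t : ℝ => (u, t)) hA h1).unique hd
  have hΦ' : HasFDerivAt Φ ((ContinuousLinearMap.fst ℝ ℝ ℝ).prod A) (u, s) :=
    hasFDerivAt_fst.prodMk hA
  have hinj : LinearMap.ker
      (((ContinuousLinearMap.fst ℝ ℝ ℝ).prod A : ℝ × ℝ →L[ℝ] ℝ × ℝ) : ℝ × ℝ →ₗ[ℝ] ℝ × ℝ) = ⊥ := by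
    rw [LinearMap.ker_eq_bot']
    rintro ⟨x, y⟩ hxy
    simp only [ContinuousLinearMap.coe_coe, ContinuousLinearMap.prod_apply,
      ContinuousLinearMap.coe_fst', Prod.mk_eq_zero] at hxy
    obtain ⟨rfl, hy⟩ := hxy
    have : ((0:ℝ), y) = y • ((0:ℝ), (1:ℝ)) := by simp
    rw [this, map_smul, hA1, smul_eq_mul, mul_eq_zero] at hy
    rcases hy with rfl | hy
    · rfl
    · exact absurd hy hd0.ne'
  let e : (ℝ × ℝ) ≃L[ℝ] (ℝ × ℝ) :=
    (LinearEquiv.ofInjectiveEndo _ (LinearMap.ker_eq_bot.1 hinj)).toContinuousLinearEquiv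
  have hΦe : HasFDerivAt Φ (e : (ℝ × ℝ) →L[ℝ] (ℝ × ℝ)) (u, s) := by
    convert! hΦ' using 1
  have hone : (1 : WithTop ℕ∞) ≠ 0 := by simp
  let P := hΦ.toOpenPartialHomeomorph Φ hΦe hone
  have hsrc : (u, s) ∈ P.source := hΦ.mem_toOpenPartialHomeomorph_source hΦe hone
  have htgt : Φ (u, s) ∈ P.target := hΦ.image_mem_toOpenPartialHomeomorph_target hΦe hone
  have hsymm : P.symm (Φ (u, s)) = (u, s) := P.left_inv hsrc
  have hcd : ContDiffAt ℝ 1 P.symm (Φ (u, s)) := by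
    refine P.contDiffAt_symm htgt (f₀' := e) ?_ ?_
    · rw [hsymm]; exact hΦe
    · rw [hsymm]; exact hΦ
  have hpos : {q : ℝ × ℝ | q ∈ OmegaSet F.ω ∧ 0 < q.2 ∧ q.1 ∈ Ioo (0:ℝ) 1} ∈ 𝓝 (u, s) :=
    Filter.inter_mem hΩ (Filter.inter_mem (continuousAt_snd.eventually (lt_mem_nhds h))
      (continuousAt_fst.eventually (Ioo_mem_nhds hu.1 hu.2)))
  have hev : ∀ᶠ q in 𝓝 (Φ (u, s)), (P.symm q ∈ OmegaSet F.ω ∧ 0 < (P.symm q).2 ∧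
      (P.symm q).1 ∈ Ioo (0:ℝ) 1) ∧ Φ (P.symm q) = q := by
    have hc := hcd.continuousAt
    have h1 : ∀ᶠ q in 𝓝 (Φ (u, s)), P.symm q ∈
        {q : ℝ × ℝ | q ∈ OmegaSet F.ω ∧ 0 < q.2 ∧ q.1 ∈ Ioo (0:ℝ) 1} := by
      apply hc.eventually
      rw [hsymm]; exact hpos
    filter_upwards [h1, P.open_target.mem_nhds htgt] with q hq1 hq2 using ⟨hq1, P.right_inv hq2⟩
  constructor
  · filter_upwards [hev] with q hq
    obtain ⟨⟨h1, h2, h3⟩, h4⟩ := hq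
    rw [← h4]
    exact ⟨h3, _, h2, h1, rfl⟩
  · refine ContDiffAt.congr_of_eventuallyEq (f := fun q => (P.symm q).2)
      (contDiffAt_snd.comp _ hcd) ?_
    filter_upwards [hev] with q hq
    obtain ⟨⟨h1, h2, h3⟩, h4⟩ := hq
    have : slopeOf F (Φ (P.symm q)).1 (Φ (P.symm q)).2 = (P.symm q).2 := slopeOf_flux h1
    rwa [h4] at this

/-- Uniform comparison of the flux with linear functions near zero slope. -/
lemma exists_flux_bounds (F : FluxData) : ∃ s₀ c M : ℝ, 0 < s₀ ∧ 0 < c ∧ c ≤ M ∧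
    ∀ u ∈ Icc (0:ℝ) 1, s₀ ∈ slopes F u ∧ ∀ s ∈ slopes F u, 0 < s →
      c * min s s₀ ≤ F.a u s ∧ min s₀ (F.a u s / M) ≤ s := by
  obtain ⟨u₀, hu₀, hmin⟩ := F.ω_lsc.exists_isMinOn (nonempty_Icc.2 zero_le_one) isCompact_Icc
  obtain ⟨r, hr0, hr⟩ := ENNReal.lt_iff_exists_nnreal_btwn.1 (F.ω_pos u₀ hu₀)
  have hr0' : (0:ℝ) < r := by exact_mod_cast hr0
  have hs₀ : ∀ u ∈ Icc (0:ℝ) 1, (r:ℝ) ∈ slopes F u := fun u hu => by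
    refine ⟨hu, ?_⟩
    simp only [abs_of_pos hr0', ENNReal.ofReal_coe_nnreal]
    exact hr.trans_le (hmin hu)
  have hsl : ∀ u ∈ Icc (0:ℝ) 1, Icc 0 (r:ℝ) ⊆ slopes F u := fun u hu =>
    (ordConnected_slopes F u).out (zero_mem_slopes F hu) (hs₀ u hu)
  set Q : Set (ℝ × ℝ) := Icc (0:ℝ) 1 ×ˢ Icc (0:ℝ) r
  have hQ : Q ⊆ OmegaSet F.ω := fun p hp => hsl p.1 hp.1 hp.2
  have hQu : UniqueDiffOn ℝ Q := (uniqueDiffOn_Icc zero_lt_one).prod (uniqueDiffOn_Icc hr0')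
  have hQC : ContDiffOn ℝ 1 (fun p : ℝ × ℝ => F.a p.1 p.2) Q := F.a_C1.mono hQ
  let D : ℝ × ℝ → ℝ := fun p => fderivWithin ℝ (fun p : ℝ × ℝ => F.a p.1 p.2) Q p (0, 1)
  have hD : ContinuousOn D Q :=
    (hQC.continuousOn_fderivWithin hQu (by simp)).clm_apply continuousOn_const
  have hDd : ∀ p ∈ Q, 0 < D p ∧ HasDerivAt (F.a p.1) (D p) p.2 := by
    rintro ⟨u, s⟩ hp
    obtain ⟨d, hd0, hd⟩ := F.a_deriv_pos u s (hQ hp)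
    have h1 : HasDerivWithinAt (fun t : ℝ => (u, t)) ((0:ℝ), (1:ℝ)) (Icc (0:ℝ) r) s :=
      ((hasDerivAt_const s u).prodMk (hasDerivAt_id s)).hasDerivWithinAt
    have h2 := ((hQC.differentiableOn (by simp)) (u, s) hp).hasFDerivWithinAt
    have h3 : HasDerivWithinAt (F.a u) (D (u, s)) (Icc (0:ℝ) r) s :=
      HasFDerivWithinAt.comp_hasDerivWithinAt s (f := fun t : ℝ => (u, t)) h2 h1
        (fun t ht => ⟨hp.1, ht⟩)
    have h4 : D (u, s) = d :=
      (uniqueDiffOn_Icc hr0' s hp.2).eq_deriv _ h3 hd.hasDerivWithinAt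
    simp only [h4]
    exact ⟨hd0, hd⟩
  have hQc : IsCompact Q := isCompact_Icc.prod isCompact_Icc
  have hQn : Q.Nonempty := ⟨(0, 0), by simp [Q]⟩
  obtain ⟨p₁, hp₁, hp₁'⟩ := hQc.exists_isMinOn hQn hD
  obtain ⟨p₂, hp₂, hp₂'⟩ := hQc.exists_isMaxOn hQn hD
  have hmv : ∀ u ∈ Icc (0:ℝ) 1, ∀ s ∈ Ioc 0 (r:ℝ), ∃ p ∈ Q, F.a u s = D p * s := by
    intro u hu s hs
    have hsub : Icc 0 s ⊆ slopes F u := (Icc_subset_Icc_right hs.2).trans (hsl u hu)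
    obtain ⟨t, ht, hte⟩ := exists_hasDerivAt_eq_slope (F.a u) (fun t => D (u, t)) hs.1
      ((continuousOn_flux F u).mono hsub)
      (fun x hx => (hDd (u, x) ⟨hu, hx.1.le, hx.2.le.trans hs.2⟩).2)
    refine ⟨(u, t), ⟨hu, ht.1.le, ht.2.le.trans hs.2⟩, ?_⟩
    rw [flux_zero F hu, sub_zero, sub_zero] at hte
    rw [hte, div_mul_cancel₀ _ hs.1.ne']
  refine ⟨r, D p₁, D p₂, hr0', (hDd _ hp₁).1, hp₁' hp₂, fun u hu => ⟨hs₀ u hu, ?_⟩⟩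
  intro s hs h
  constructor
  · have hm : min s r ∈ Ioc 0 (r:ℝ) := ⟨lt_min h hr0', min_le_right _ _⟩
    obtain ⟨p, hp, he⟩ := hmv u hu _ hm
    calc D p₁ * min s r ≤ D p * min s r := mul_le_mul_of_nonneg_right (hp₁' hp) hm.1.le
      _ = F.a u (min s r) := he.symm
      _ ≤ F.a u s := (strictMonoOn_flux F u).monotoneOn (hsl u hu ⟨hm.1.le, hm.2⟩) hs
          (min_le_left _ _)
  · rcases le_total s r with hsr | hsr
    · obtain ⟨p, hp, he⟩ := hmv u hu s ⟨h, hsr⟩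
      refine (min_le_right _ _).trans ?_
      rw [div_le_iff₀ (hDd _ hp₂).1, he, mul_comm]
      exact mul_le_mul_of_nonneg_left (hp₂' hp) h.le
    · exact (min_le_left _ _).trans hsr

lemma exists_reaction_bound (F : FluxData) :
    ∃ L : ℝ, 0 < L ∧ ∀ x ∈ Icc (0:ℝ) 1, F.f x ≤ L * (x * (1 - x)) := by
  have hloc : LocallyLipschitzOn (Icc (0:ℝ) 1) F.f := by
    intro x hx
    exact (F.f_C1 x hx).exists_lipschitzOnWith (convex_Icc 0 1)
  obtain ⟨K, hK⟩ := hloc.exists_lipschitzOnWith_of_compact isCompact_Icc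
  refine ⟨2 * (K + 1), by positivity, fun x hx => ?_⟩
  have h0 := hK.dist_le_mul x hx 0 (by simp)
  have h1 := hK.dist_le_mul x hx 1 (by simp)
  rw [F.f_zero, Real.dist_eq, Real.dist_eq, sub_zero, sub_zero, abs_of_nonneg hx.1] at h0
  rw [F.f_one, Real.dist_eq, Real.dist_eq, sub_zero, abs_sub_comm,
    abs_of_nonneg (sub_nonneg.2 hx.2)] at h1
  replace h0 := (le_abs_self _).trans h0
  replace h1 := (le_abs_self _).trans h1
  have hK0 : (0:ℝ) ≤ K := K.2
  have hx0 := hx.1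
  have hx1 : 0 ≤ 1 - x := by linarith [hx.2]
  rcases le_total x (1 / 2) with h | h
  · nlinarith [mul_nonneg hK0 hx0, mul_nonneg hx0 hx1, mul_nonneg (mul_nonneg hK0 hx0) (by linarith : 0 ≤ 1 - 2 * x)]
  · nlinarith [mul_nonneg hK0 hx0, mul_nonneg hx0 hx1, mul_nonneg (mul_nonneg hK0 hx1) (by linarith : 0 ≤ 2 * x - 1)]

/-- Picard–Lindelöf for a bounded, globally Lipschitz scalar field on a compact time interval. -/
lemma exists_solution_on_Icc {v : ℝ → ℝ → ℝ} {a b t₀ : ℝ} {K B : NNReal} (ht₀ : t₀ ∈ Icc a b)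
    (x₀ : ℝ) (hLip : ∀ t ∈ Icc a b, LipschitzWith K (v t))
    (hcont : ∀ x, ContinuousOn (v · x) (Icc a b)) (hB : ∀ t ∈ Icc a b, ∀ x, ‖v t x‖ ≤ B) :
    ∃ X : ℝ → ℝ, X t₀ = x₀ ∧ ∀ t ∈ Icc a b, HasDerivWithinAt X (v t (X t)) (Icc a b) t := by
  have hpl : IsPicardLindelof v (⟨t₀, ht₀⟩ : Icc a b) x₀ (B * (b - a).toNNReal) 0 B K := by
    refine ⟨fun t ht => (hLip t ht).lipschitzOnWith, fun x _ => hcont x,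
      fun t ht x _ => hB t ht x, ?_⟩
    have hab : a ≤ b := ht₀.1.trans ht₀.2
    simp only [NNReal.coe_mul, Real.coe_toNNReal _ (sub_nonneg.2 hab), NNReal.coe_zero, sub_zero]
    refine mul_le_mul_of_nonneg_left (max_le ?_ ?_) B.2
    · linarith [ht₀.1]
    · linarith [ht₀.2]
  exact hpl.exists_eq_forall_mem_Icc_hasDerivWithinAt₀

lemma HasDerivWithinAt.Ici_of_Icc {f : ℝ → ℝ} {f' a b t : ℝ} (ht : t ∈ Ico a b)
    (h : HasDerivWithinAt f f' (Icc a b) t) : HasDerivWithinAt f f' (Ici t) t :=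
  h.mono_of_mem_nhdsWithin (Icc_mem_nhdsGE_of_mem ht)

/-- The right-hand side of the first-order equation satisfied by the flux of a wave,
as a function of its value. -/
def fluxField (F : FluxData) (σ u v : ℝ) : ℝ := σ - F.f u / slopeOf F u v

lemma contDiffAt_fluxField {F : FluxData} (σ : ℝ) {p : ℝ × ℝ} (hp : p ∈ fluxRegion F) :
    ContDiffAt ℝ 1 (fun q : ℝ × ℝ => fluxField F σ q.1 q.2) p := by
  have hf : ContDiffAt ℝ 1 F.f p.1 := F.f_C1.contDiffAt (Icc_mem_nhds hp.1.1 hp.1.2)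
  exact contDiffAt_const.sub ((hf.comp p contDiffAt_fst).div
    (fluxRegion_nhds_and_contDiffAt hp).2 (slopeOf_spec hp).1.ne')

/-- `fluxField` with its last argument projected onto `[δ, W u]`. -/
def clampedField (F : FluxData) (σ : ℝ) (W : ℝ → ℝ) (δ u v : ℝ) : ℝ :=
  fluxField F σ u (max δ (min v (W u)))

lemma clampedField_eq {F : FluxData} {σ : ℝ} {W : ℝ → ℝ} {δ u v : ℝ} (h : δ ≤ v) (h' : v ≤ W u) :
    clampedField F σ W δ u v = fluxField F σ u v := by
  rw [clampedField, min_eq_left h', max_eq_right h]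

lemma exists_clampedField_bounds (F : FluxData) (σ : ℝ) {W : ℝ → ℝ} {a b δ : ℝ} (hδ : 0 < δ)
    (hW : ContinuousOn W (Icc a b)) (hδW : ∀ t ∈ Icc a b, δ ≤ W t)
    (hreg : ∀ t ∈ Icc a b, (t, W t) ∈ fluxRegion F) :
    ∃ K B : NNReal, (∀ t ∈ Icc a b, LipschitzWith K (clampedField F σ W δ t)) ∧
      (∀ x, ContinuousOn (clampedField F σ W δ · x) (Icc a b)) ∧
      ∀ t ∈ Icc a b, ∀ x, ‖clampedField F σ W δ t x‖ ≤ B := by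
  obtain ⟨m, hm⟩ := isCompact_Icc.bddAbove_image hW
  set C : Set (ℝ × ℝ) := {p ∈ Icc a b ×ˢ Icc δ m | p.2 ≤ W p.1} with hC
  have hCc : IsCompact C := by
    refine (isCompact_Icc.prod isCompact_Icc).of_isClosed_subset
      ((isClosed_Icc.prod isClosed_Icc).isClosed_le continuousOn_snd
        (hW.comp continuousOn_fst fun p hp => hp.1)) fun p hp => hp.1
  have hCr : C ⊆ fluxRegion F := fun p hp =>
    fluxRegion_of_le (hreg p.1 hp.1.1) (hδ.trans_le hp.1.2.1) hp.2
  set H : ℝ × ℝ → ℝ := fun q => fluxField F σ q.1 q.2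
  have hHcont : ContinuousOn H C := fun p hp =>
    (contDiffAt_fluxField σ (hCr hp)).continuousAt.continuousWithinAt
  have hloc : LocallyLipschitzOn C H := fun p hp => by
    obtain ⟨K, t, ht, h⟩ := (contDiffAt_fluxField σ (hCr hp)).exists_lipschitzOnWith
    exact ⟨K, t, mem_nhdsWithin_of_mem_nhds ht, h⟩
  obtain ⟨K, hK⟩ := hloc.exists_lipschitzOnWith_of_compact hCc
  obtain ⟨B, hB⟩ := hCc.exists_bound_of_continuousOn hHcont
  have hmem : ∀ t ∈ Icc a b, ∀ x, (t, max δ (min x (W t))) ∈ C := fun t ht x =>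
    have h : max δ (min x (W t)) ≤ W t := max_le (hδW t ht) (min_le_right _ _)
    ⟨⟨ht, le_max_left _ _, h.trans (hm ⟨t, ht, rfl⟩)⟩, h⟩
  refine ⟨K, B.toNNReal, fun t ht => ?_, fun x => ?_, fun t ht x => ?_⟩
  · refine LipschitzWith.of_dist_le_mul fun x y => ?_
    have h1 := hK.dist_le_mul _ (hmem t ht x) _ (hmem t ht y)
    have h2 : LipschitzWith 1 fun x => max δ (min x (W t)) :=
      (LipschitzWith.id.min_const _).const_max _
    have h3 := h2.dist_le_mul x y
    rw [NNReal.coe_one, one_mul] at h3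
    refine h1.trans (mul_le_mul_of_nonneg_left ?_ K.2)
    rw [Prod.dist_eq, dist_self]
    exact max_le dist_nonneg h3
  · exact hHcont.comp (f := fun t => (t, max δ (min x (W t))))
      (continuousOn_id.prodMk (continuousOn_const.sup (continuousOn_const.inf hW)))
      fun t ht => hmem t ht x
  · exact (hB _ (hmem t ht x)).trans (Real.le_coe_toNNReal B)

/-- On compact subintervals of `(0,1)` the field tends uniformly to `-∞` as the flux
tends to zero. -/
lemma exists_fluxField_le (F : FluxData) (σ N : ℝ) {a b : ℝ} (ha : 0 < a) (hb : b < 1) :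
    ∃ δ₀ > 0, ∀ t ∈ Icc a b, ∀ v ≤ δ₀, (t, v) ∈ fluxRegion F → fluxField F σ t v ≤ -N := by
  obtain ⟨s₀, c, M, hs₀, hc, -, hbd⟩ := exists_flux_bounds F
  rcases (Icc a b).eq_empty_or_nonempty with he | hne
  · exact ⟨1, one_pos, by simp [he]⟩
  have hsub : Icc a b ⊆ Icc 0 1 := Icc_subset_Icc ha.le hb.le
  obtain ⟨t₁, ht₁, hmin⟩ := isCompact_Icc.exists_isMinOn hne (F.f_C1.continuousOn.mono hsub)
  have hm : 0 < F.f t₁ := F.f_pos t₁ ⟨ha.trans_le ht₁.1, ht₁.2.trans_lt hb⟩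
  have hA : 0 < |σ| + |N| + 1 := by positivity
  refine ⟨min (c * s₀ / 2) (F.f t₁ * c / (|σ| + |N| + 1)), lt_min (by positivity) (by positivity),
    fun t ht v hv hr => ?_⟩
  have hv0 : 0 < v := fluxRegion_snd_pos hr
  obtain ⟨h0, hs, e⟩ := slopeOf_spec hr
  simp only at h0 hs e
  obtain ⟨-, h⟩ := hbd t (hsub ht)
  have h1 := (h _ hs h0).1
  rw [e] at h1
  have h2 : c * slopeOf F t v ≤ v := by
    rcases le_total (slopeOf F t v) s₀ with h3 | h3
    · rwa [min_eq_left h3] at h1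
    · rw [min_eq_right h3] at h1
      have := hv.trans (min_le_left _ _)
      nlinarith [mul_pos hc hs₀]
  have h3 : v * (|σ| + |N| + 1) ≤ F.f t₁ * c := (le_div_iff₀ hA).1 (hv.trans (min_le_right _ _))
  have h4 : |σ| + |N| + 1 ≤ F.f t / slopeOf F t v := by
    rw [le_div_iff₀ h0]
    have h5 : F.f t₁ ≤ F.f t := hmin ht
    have h6 : c * ((|σ| + |N| + 1) * slopeOf F t v) ≤ c * F.f t := by nlinarith
    exact le_of_mul_le_mul_left h6 hc
  unfold fluxField
  linarith [le_abs_self σ, le_abs_self N]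

/-- `W` is a strict upper barrier for `fluxField F σ` on `(0,1)`. -/
def IsBarrier (F : FluxData) (σ : ℝ) (W : ℝ → ℝ) : Prop :=
  ∀ x ∈ Ioo (0:ℝ) 1, (x, W x) ∈ fluxRegion F ∧
    ∃ W', HasDerivAt W W' x ∧ W' < fluxField F σ x (W x)

/-- `V` is a positive solution below `W` on `[a,b]`. -/
def IsSolutionBelow (F : FluxData) (σ : ℝ) (W : ℝ → ℝ) (a b : ℝ) (V : ℝ → ℝ) : Prop :=
  ∀ t ∈ Icc a b, 0 < V t ∧ V t ≤ W t ∧ HasDerivWithinAt V (fluxField F σ t (V t)) (Icc a b) t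

lemma IsBarrier.exists_solutionBelow {F : FluxData} {σ : ℝ} {W : ℝ → ℝ} (hW : IsBarrier F σ W)
    {a b : ℝ} (ha : 0 < a) (hab : a ≤ b) (hb : b < 1) : ∃ V, IsSolutionBelow F σ W a b V := by
  have hsub : Icc a b ⊆ Ioo 0 1 := fun t ht => ⟨ha.trans_le ht.1, ht.2.trans_lt hb⟩
  choose! hreg W' hW' hlt using hW
  have hWc : ContinuousOn W (Icc a b) := fun t ht =>
    (hW' t (hsub ht)).continuousAt.continuousWithinAt
  obtain ⟨t₁, ht₁, hmin⟩ := isCompact_Icc.exists_isMinOn (nonempty_Icc.2 hab) hWc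
  have hm : 0 < W t₁ := fluxRegion_snd_pos (hreg t₁ (hsub ht₁))
  obtain ⟨δ₀, hδ₀, hfield⟩ := exists_fluxField_le F σ 1 ha hb
  set δ := min δ₀ (W t₁)
  have hδ : 0 < δ := lt_min hδ₀ hm
  have hδW : ∀ t ∈ Icc a b, δ ≤ W t := fun t ht => (min_le_right _ _).trans (hmin ht)
  obtain ⟨K, B, hK, hcont, hB⟩ := exists_clampedField_bounds F σ hδ hWc hδW
    fun t ht => hreg t (hsub ht)
  obtain ⟨V, hVb, hV⟩ := exists_solution_on_Icc (right_mem_Icc.2 hab) (W b) hK hcont hB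
  have hVc : ContinuousOn V (Icc a b) := fun t ht => (hV t ht).continuousWithinAt
  have hright : ∀ t₁ ∈ Icc a b, ∀ t ∈ Ico t₁ b,
      HasDerivWithinAt V (clampedField F σ W δ t (V t)) (Ici t) t := fun t₁ ht₁ t ht =>
    HasDerivWithinAt.Ici_of_Icc ⟨ht₁.1.trans ht.1, ht.2⟩ (hV t ⟨ht₁.1.trans ht.1, ht.2.le⟩)
  have hle : ∀ t ∈ Icc a b, V t ≤ W t := by
    intro t₁ ht₁
    by_contra! hcon
    have hs : Icc t₁ b ⊆ Icc a b := Icc_subset_Icc_left ht₁.1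
    have key := image_le_of_deriv_right_lt_deriv_boundary' (a := t₁) (b := b)
      (f := fun t => W t + (V t₁ - W t₁)) (f' := W') (B := V)
      (B' := fun t => clampedField F σ W δ t (V t))
      ((hWc.mono hs).add continuousOn_const)
      (fun t ht => ((hW' t (hsub (hs (Ico_subset_Icc_self ht)))).add_const _).hasDerivWithinAt)
      (by linarith) (hVc.mono hs) (hright t₁ ht₁)
      (fun t ht hte => by
        have ht' := hs (Ico_subset_Icc_self ht)
        have h1 : W t ≤ V t := by linarith
        rw [clampedField, min_eq_right h1, max_eq_right (hδW t ht')]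
        exact hlt t (hsub ht'))
      (right_mem_Icc.2 ht₁.2)
    linarith
  have hge : ∀ t ∈ Icc a b, δ ≤ V t := by
    intro t₁ ht₁
    by_contra! hcon
    have hs : Icc t₁ b ⊆ Icc a b := Icc_subset_Icc_left ht₁.1
    have key := image_le_of_deriv_right_lt_deriv_boundary' (a := t₁) (b := b)
      (f := V) (f' := fun t => clampedField F σ W δ t (V t)) (B := fun _ => V t₁) (B' := 0)
      (hVc.mono hs) (hright t₁ ht₁) le_rfl continuousOn_const
      (fun t _ => hasDerivWithinAt_const _ _ _)
      (fun t ht hte => by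
        have ht' := hs (Ico_subset_Icc_self ht)
        have h1 : min (V t) (W t) ≤ δ := by rw [hte]; exact (min_le_left _ _).trans hcon.le
        rw [clampedField, max_eq_left h1]
        have := hfield t ht' δ (min_le_left _ _)
          (fluxRegion_of_le (hreg t (hsub ht')) hδ (hδW t ht'))
        simp only [Pi.zero_apply]
        linarith)
      (right_mem_Icc.2 ht₁.2)
    linarith [hδW b (right_mem_Icc.2 hab)]
  refine ⟨V, fun t ht => ⟨hδ.trans_le (hge t ht), hle t ht, ?_⟩⟩
  have := hV t ht
  rwa [clampedField_eq (hge t ht) (hle t ht)] at this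

/-- Positive solutions on `[a,b']` are bounded below on `[a,b]`, uniformly in the solution. -/
lemma exists_lower_bound (F : FluxData) (σ : ℝ) {W : ℝ → ℝ} {a b b' : ℝ} (ha : 0 < a)
    (hbb' : b < b') (hb' : b' < 1) (hW : ∀ t ∈ Icc a b', (t, W t) ∈ fluxRegion F) :
    ∃ δ > 0, ∀ V, IsSolutionBelow F σ W a b' V → ∀ t ∈ Icc a b, δ ≤ V t := by
  obtain ⟨δ₀, hδ₀, hfield⟩ := exists_fluxField_le F σ (1 + 1 / (b' - b)) ha hb'
  have hd : 0 < b' - b := sub_pos.2 hbb'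
  refine ⟨min δ₀ 1, lt_min hδ₀ one_pos, fun V hV t₁ ht₁ => ?_⟩
  by_contra! hcon
  have ht₁b : t₁ ≤ b' := ht₁.2.trans hbb'.le
  have hs : Icc t₁ b' ⊆ Icc a b' := Icc_subset_Icc_left ht₁.1
  have key := image_le_of_deriv_right_lt_deriv_boundary' (a := t₁) (b := b')
    (f := V) (f' := fun t => fluxField F σ t (V t))
    (B := fun t => V t₁ - (1 / (b' - b)) * (t - t₁)) (B' := fun _ => -(1 / (b' - b)))
    (fun t ht => (hV t (hs ht)).2.2.continuousWithinAt.mono hs)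
    (fun t ht => HasDerivWithinAt.Ici_of_Icc ⟨ht₁.1.trans ht.1, ht.2⟩
      (hV t (hs (Ico_subset_Icc_self ht))).2.2)
    (by simp) (by fun_prop)
    (fun t _ => by
      have h := (((hasDerivAt_id t).sub_const t₁).const_mul (1 / (b' - b))).const_sub (V t₁)
      simpa using h.hasDerivWithinAt)
    (fun t ht hte => by
      have ht' := hs (Ico_subset_Icc_self ht)
      obtain ⟨h0, h1, -⟩ := hV t ht'
      have h2 : 0 ≤ (1 / (b' - b)) * (t - t₁) :=
        mul_nonneg (by positivity) (sub_nonneg.2 ht.1)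
      have h3 := hfield t ht' (V t) (by linarith [min_le_left δ₀ 1])
        (fluxRegion_of_le (hW t ht') h0 h1)
      linarith)
    (right_mem_Icc.2 ht₁b)
  have h4 := (hV b' (right_mem_Icc.2 (ht₁.1.trans ht₁b))).1
  have h5 : 1 ≤ (1 / (b' - b)) * (b' - t₁) := by
    rw [one_div_mul_eq_div, le_div_iff₀ hd]
    linarith [ht₁.2]
  linarith [min_le_right δ₀ 1]

/-- Below a strict barrier there is a positive solution on all of `(0,1)`. -/
lemma IsBarrier.exists_solution {F : FluxData} {σ : ℝ} {W : ℝ → ℝ} (hW : IsBarrier F σ W) :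
    ∃ V : ℝ → ℝ, ∀ x ∈ Ioo (0:ℝ) 1, 0 < V x ∧ V x ≤ W x ∧
      HasDerivAt V (fluxField F σ x (V x)) x := by
  let ε : ℕ → ℝ := fun n => 1 / ((n:ℝ) + 1) / 2
  have hε0 : ∀ n, 0 < ε n := fun n => by positivity
  have hε1 : ∀ n, ε n ≤ 1 / 2 := fun n => by
    have : 1 / ((n:ℝ) + 1) ≤ 1 := by
      rw [div_le_one (by positivity)]; linarith [n.cast_nonneg (α := ℝ)]
    simp only [ε]; linarith
  have hεlim : Tendsto ε atTop (𝓝 0) := by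
    simpa [ε] using (tendsto_one_div_add_atTop_nhds_zero_nat (𝕜 := ℝ)).div_const 2
  choose Vn hVn using fun n => hW.exists_solutionBelow (a := ε n) (b := 1 - ε n) (hε0 n)
    (by linarith [hε1 n]) (by linarith [hε0 n])
  let U : Ultrafilter ℕ := hyperfilter ℕ
  have hU : (U : Filter ℕ) ≤ atTop := Nat.hyperfilter_le_atTop
  have hev : ∀ a b : ℝ, 0 < a → b < 1 → ∀ᶠ n in (U : Filter ℕ), ε n ≤ a ∧ b ≤ 1 - ε n := by
    intro a b ha hb
    apply hU
    filter_upwards [hεlim.eventually (gt_mem_nhds ha),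
      hεlim.eventually (gt_mem_nhds (sub_pos.2 hb))] with n h1 h2
    exact ⟨h1.le, by linarith⟩
  have hlim : ∀ x ∈ Ioo (0:ℝ) 1, ∃ y ≤ W x, Tendsto (fun n => Vn n x) U (𝓝 y) := by
    intro x hx
    have h1 : ∀ᶠ n in (U : Filter ℕ), Vn n x ∈ Icc 0 (W x) := by
      filter_upwards [hev x x hx.1 hx.2] with n hn
      exact ⟨(hVn n x hn).1.le, (hVn n x hn).2.1⟩
    obtain ⟨y, hy, hy'⟩ := isCompact_Icc.ultrafilter_le_nhds (U.map fun n => Vn n x)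
      (le_principal_iff.2 h1)
    exact ⟨y, hy.2, hy'⟩
  choose! V hVW hVlim using hlim
  have main : ∀ a b : ℝ, 0 < a → a ≤ b → b < 1 → ∀ t ∈ Icc a b,
      0 < V t ∧ HasDerivWithinAt V (fluxField F σ t (V t)) (Icc a b) t := by
    intro a b ha hab hb
    have hsub : Icc a b ⊆ Ioo 0 1 := fun t ht => ⟨ha.trans_le ht.1, ht.2.trans_lt hb⟩
    have hb1 : (b + 1) / 2 < 1 := by linarith
    obtain ⟨δ, hδ, hlow⟩ := exists_lower_bound F σ (W := W) (b := b) ha (by linarith) hb1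
      fun t ht => (hW t ⟨ha.trans_le ht.1, ht.2.trans_lt hb1⟩).1
    have hgood : ∀ᶠ n in (U : Filter ℕ), ∀ t ∈ Icc a b, δ ≤ Vn n t ∧ Vn n t ≤ W t ∧
        HasDerivWithinAt (Vn n) (fluxField F σ t (Vn n t)) (Icc a b) t := by
      filter_upwards [hev a ((b + 1) / 2) ha hb1] with n hn t ht
      have hs : Icc a ((b + 1) / 2) ⊆ Icc (ε n) (1 - ε n) := Icc_subset_Icc hn.1 hn.2
      have ht' : t ∈ Icc a ((b + 1) / 2) := ⟨ht.1, ht.2.trans (by linarith)⟩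
      refine ⟨hlow (Vn n) (fun r hr => ?_) t ht, (hVn n t (hs ht')).2.1,
        (hVn n t (hs ht')).2.2.mono
          ((Icc_subset_Icc_right (by linarith)).trans hs)⟩
      exact ⟨(hVn n r (hs hr)).1, (hVn n r (hs hr)).2.1, (hVn n r (hs hr)).2.2.mono hs⟩
    obtain ⟨n₀, hn₀⟩ := hgood.exists
    have hWc : ContinuousOn W (Icc a b) := fun t ht => by
      obtain ⟨-, W', h, -⟩ := hW t (hsub ht)
      exact h.continuousAt.continuousWithinAt
    obtain ⟨K, B, hK, hcont, hB⟩ := exists_clampedField_bounds F σ hδ hWc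
      (fun t ht => (hn₀ t ht).1.trans (hn₀ t ht).2.1) fun t ht => (hW t (hsub ht)).1
    obtain ⟨X, hXa, hX⟩ := exists_solution_on_Icc (left_mem_Icc.2 hab) (V a) hK hcont hB
    have hXV : ∀ t ∈ Icc a b, V t = X t := by
      intro t ht
      refine tendsto_nhds_unique (hVlim t (hsub ht)) ?_
      rw [tendsto_iff_dist_tendsto_zero]
      have h1 : Tendsto (fun n => dist (Vn n a) (X a) * Real.exp (K * (t - a))) U (𝓝 0) := by
        have h2 := tendsto_iff_dist_tendsto_zero.1 (hVlim a (hsub (left_mem_Icc.2 hab)))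
        rw [← hXa] at h2
        simpa using h2.mul_const (Real.exp (K * (t - a)))
      refine squeeze_zero' (Eventually.of_forall fun _ => dist_nonneg) ?_ h1
      filter_upwards [hgood] with n hn
      refine dist_le_of_trajectories_ODE_of_mem (v := clampedField F σ W δ) (s := fun _ => univ)
        (K := K) (b := b)
        (fun r hr => (hK r (Ico_subset_Icc_self hr)).lipschitzOnWith)
        (fun r hr => (hn r hr).2.2.continuousWithinAt)
        (fun r hr => ?_) (fun _ _ => trivial)
        (fun r hr => (hX r hr).continuousWithinAt)
        (fun r hr => HasDerivWithinAt.Ici_of_Icc hr (hX r (Ico_subset_Icc_self hr)))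
        (fun _ _ => trivial) le_rfl t ht
      obtain ⟨h3, h4, h5⟩ := hn r (Ico_subset_Icc_self hr)
      rw [clampedField_eq h3 h4]
      exact HasDerivWithinAt.Ici_of_Icc hr h5
    intro t ht
    have hδV : δ ≤ V t := by
      refine ge_of_tendsto (hVlim t (hsub ht)) ?_
      filter_upwards [hgood] with n hn using (hn t ht).1
    refine ⟨hδ.trans_le hδV, ?_⟩
    have h6 := (hX t ht).congr hXV (hXV t ht)
    rwa [← hXV t ht, clampedField_eq hδV (hVW t (hsub ht))] at h6
  refine ⟨V, fun x hx => ?_⟩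
  obtain ⟨h1, h2⟩ := main (x / 2) ((x + 1) / 2) (by linarith [hx.1]) (by linarith [hx.1, hx.2])
    (by linarith [hx.2]) x ⟨by linarith [hx.1], by linarith [hx.2]⟩
  exact ⟨h1, hVW x hx, h2.hasDerivAt
    (Icc_mem_nhds (by linarith [hx.1]) (by linarith [hx.2]))⟩

/-- A differentiable strictly increasing bijection between open sets of reals, with nonvanishing
derivative, has a differentiable inverse. -/
lemma exists_differentiable_inverse {I J : Set ℝ} (hI : IsOpen I) (hJ : IsOpen J) {T T' : ℝ → ℝ}
    (hT : BijOn T I J) (hmono : StrictMonoOn T I) (hd : ∀ x ∈ I, HasDerivAt T (T' x) x)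
    (hne : ∀ x ∈ I, T' x ≠ 0) :
    ∃ ψ : ℝ → ℝ, (∀ y ∈ J, ψ y ∈ I ∧ T (ψ y) = y ∧ HasDerivAt ψ (T' (ψ y))⁻¹ y) ∧
      ∀ x ∈ I, ψ (T x) = x := by
  have hr : ∀ y ∈ J, Function.invFunOn T I y ∈ I ∧ T (Function.invFunOn T I y) = y :=
    fun y hy => Function.invFunOn_pos (hT.surjOn hy)
  have hl : ∀ x ∈ I, Function.invFunOn T I (T x) = x := hT.injOn.leftInvOn_invFunOn
  have himage : Function.invFunOn T I '' J = I := by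
    refine Subset.antisymm (image_subset_iff.2 fun y hy => (hr y hy).1) fun x hx => ?_
    exact ⟨T x, hT.mapsTo hx, hl x hx⟩
  have hmono' : StrictMonoOn (Function.invFunOn T I) J := fun y hy z hz hyz => by
    rw [← hmono.lt_iff_lt (hr y hy).1 (hr z hz).1, (hr y hy).2, (hr z hz).2]
    exact hyz
  refine ⟨Function.invFunOn T I, fun y hy => ⟨(hr y hy).1, (hr y hy).2, ?_⟩, hl⟩
  have hc : ContinuousAt (Function.invFunOn T I) y :=
    hmono'.continuousAt_of_image_mem_nhds (hJ.mem_nhds hy)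
      (by rw [himage]; exact hI.mem_nhds (hr y hy).1)
  refine (hd _ (hr y hy).1).of_local_left_inverse hc (hne _ (hr y hy).1) ?_
  filter_upwards [hJ.mem_nhds hy] with z hz using (hr z hz).2

/-- A flow in `(0,1)` whose speed decays linearly at both ends is defined for all times and
connects `0` to `1`. -/
lemma exists_global_trajectory {h : ℝ → ℝ} {C : ℝ} (hc : ContinuousOn h (Ioo 0 1))
    (hpos : ∀ x ∈ Ioo (0:ℝ) 1, 0 < h x) (hC : ∀ x ∈ Ioo (0:ℝ) 1, h x ≤ C * (x * (1 - x))) :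
    ∃ u : ℝ → ℝ, (∀ ξ, u ξ ∈ Ioo (0:ℝ) 1) ∧ (∀ ξ, HasDerivAt u (h (u ξ)) ξ) ∧
      Tendsto u atBot (𝓝 0) ∧ Tendsto u atTop (𝓝 1) := by
  have hhalf : (1 / 2 : ℝ) ∈ Ioo (0:ℝ) 1 := by norm_num
  have hC0 : 0 < C := by
    have h1 := hpos _ hhalf
    have h2 := hC _ hhalf
    norm_num at h2
    nlinarith
  have hic : ContinuousOn (fun x => (h x)⁻¹) (Ioo 0 1) := hc.inv₀ fun x hx => (hpos x hx).ne'
  let T : ℝ → ℝ := fun x => ∫ t in (1 / 2 : ℝ)..x, (h t)⁻¹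
  have hT : ∀ x ∈ Ioo (0:ℝ) 1, HasDerivAt T (h x)⁻¹ x := by
    intro x hx
    have hsub : uIcc (1 / 2 : ℝ) x ⊆ Ioo 0 1 := ordConnected_Ioo.uIcc_subset hhalf hx
    exact intervalIntegral.integral_hasDerivAt_right (hic.mono hsub).intervalIntegrable
      (hic.stronglyMeasurableAtFilter isOpen_Ioo x hx)
      (hic.continuousAt (isOpen_Ioo.mem_nhds hx))
  have hT0 : T (1 / 2) = 0 := intervalIntegral.integral_same
  have hTc : ContinuousOn T (Ioo 0 1) := fun x hx => (hT x hx).continuousAt.continuousWithinAt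
  have hTmono : StrictMonoOn T (Ioo 0 1) := by
    refine strictMonoOn_of_deriv_pos (convex_Ioo 0 1) hTc fun x hx => ?_
    rw [interior_Ioo] at hx
    rw [(hT x hx).deriv]
    exact inv_pos.2 (hpos x hx)
  let ℓ : ℝ → ℝ := fun x => Real.log x - Real.log (1 - x)
  have hℓ : ∀ x ∈ Ioo (0:ℝ) 1, HasDerivAt ℓ (x * (1 - x))⁻¹ x := by
    intro x hx
    have hx1 : 0 < 1 - x := sub_pos.2 hx.2
    have h1 := (Real.hasDerivAt_log hx.1.ne').sub
      (((hasDerivAt_id x).const_sub 1).log hx1.ne')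
    convert! h1 using 1
    have := hx.1.ne'
    have := hx1.ne'
    simp only [id]
    field_simp
    ring
  have hdiff : MonotoneOn (fun x => T x - ℓ x / C) (Ioo 0 1) := by
    have hd : ∀ x ∈ Ioo (0:ℝ) 1,
        HasDerivAt (fun x => T x - ℓ x / C) ((h x)⁻¹ - (x * (1 - x))⁻¹ / C) x :=
      fun x hx => (hT x hx).sub ((hℓ x hx).div_const C)
    refine monotoneOn_of_deriv_nonneg (convex_Ioo 0 1)
      (fun x hx => (hd x hx).continuousAt.continuousWithinAt)
      (fun x hx => ((hd x (interior_subset hx)).differentiableAt).differentiableWithinAt) ?_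
    intro x hx
    rw [interior_Ioo] at hx
    rw [(hd x hx).deriv, sub_nonneg, div_eq_mul_inv, ← mul_inv, mul_comm]
    exact inv_anti₀ (hpos x hx) (hC x hx)
  have hsurj : SurjOn T (Ioo 0 1) univ := by
    intro y _
    set k := C * |y|
    have hk : 0 ≤ k := by positivity
    set e := Real.exp (-k) with he
    have he0 : 0 < e := Real.exp_pos _
    have he1 : e ≤ 1 := Real.exp_le_one_iff.2 (by linarith)
    set x₂ := 1 / (1 + e) with hx₂
    have hx₂' : 1 - x₂ = e * x₂ := by rw [hx₂]; field_simp; ring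
    have hx₂0 : 0 < x₂ := by positivity
    have hx₂1 : 0 < 1 - x₂ := by rw [hx₂']; positivity
    have hx₂h : 1 / 2 ≤ x₂ := by nlinarith
    have hlog : Real.log (1 - x₂) = -k + Real.log x₂ := by
      rw [hx₂', Real.log_mul he0.ne' hx₂0.ne', he, Real.log_exp]
    have hm₂ : x₂ ∈ Ioo (0:ℝ) 1 := ⟨hx₂0, by linarith⟩
    have hm₁ : 1 - x₂ ∈ Ioo (0:ℝ) 1 := ⟨hx₂1, by linarith⟩
    have hℓh : ℓ (1 / 2) = 0 := by norm_num [ℓ]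
    have hℓ₂ : ℓ x₂ = k := by simp only [ℓ, hlog]; ring
    have hℓ₁ : ℓ (1 - x₂) = -k := by simp only [ℓ, hlog, sub_sub_cancel]; ring
    have hkC : k / C = |y| := by simp only [k]; field_simp
    have h2 := hdiff hhalf hm₂ hx₂h
    have h1 := hdiff hm₁ hhalf (by linarith)
    simp only [hT0, hℓh, hℓ₂, hℓ₁, hkC, neg_div, zero_div] at h1 h2
    have hsub : Icc (1 - x₂) x₂ ⊆ Ioo 0 1 := ordConnected_Ioo.out hm₁ hm₂
    obtain ⟨x, hx, hxy⟩ := intermediate_value_Icc (by linarith : 1 - x₂ ≤ x₂) (hTc.mono hsub)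
      (⟨by linarith [neg_abs_le y], by linarith [le_abs_self y]⟩ : y ∈ Icc (T (1 - x₂)) (T x₂))
    exact ⟨x, hsub hx, hxy⟩
  obtain ⟨u, hu, hu'⟩ := exists_differentiable_inverse isOpen_Ioo isOpen_univ
    ⟨mapsTo_univ _ _, hTmono.injOn, hsurj⟩ hTmono hT fun x hx => inv_ne_zero (hpos x hx).ne'
  have hu1 : ∀ ξ, u ξ ∈ Ioo (0:ℝ) 1 := fun ξ => (hu ξ trivial).1
  have hult : ∀ ξ, ∀ x ∈ Ioo (0:ℝ) 1, ξ < T x → u ξ < x := fun ξ x hx hlt => by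
    rwa [← hTmono.lt_iff_lt (hu1 ξ) hx, (hu ξ trivial).2.1]
  have hugt : ∀ ξ, ∀ x ∈ Ioo (0:ℝ) 1, T x < ξ → x < u ξ := fun ξ x hx hlt => by
    rwa [← hTmono.lt_iff_lt hx (hu1 ξ), (hu ξ trivial).2.1]
  refine ⟨u, hu1, fun ξ => by simpa using (hu ξ trivial).2.2, ?_, ?_⟩
  · refine tendsto_order.2 ⟨fun x hx => Eventually.of_forall fun ξ => hx.trans (hu1 ξ).1,
      fun x hx => ?_⟩
    have hm : min x (1 / 2) ∈ Ioo (0:ℝ) 1 :=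
      ⟨lt_min hx (by norm_num), (min_le_right _ _).trans_lt (by norm_num)⟩
    filter_upwards [eventually_lt_atBot (T (min x (1 / 2)))] with ξ hξ
    exact (hult ξ _ hm hξ).trans_le (min_le_left _ _)
  · refine tendsto_order.2 ⟨fun x hx => ?_,
      fun x hx => Eventually.of_forall fun ξ => (hu1 ξ).2.trans hx⟩
    have hm : max x (1 / 2) ∈ Ioo (0:ℝ) 1 :=
      ⟨lt_max_of_lt_right (by norm_num), max_lt hx (by norm_num)⟩
    filter_upwards [eventually_gt_atTop (T (max x (1 / 2)))] with ξ hξ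
    exact (le_max_left _ _).trans_lt (hugt ξ _ hm hξ)

/-- `V` is the flux of a wave, as a function of its value. -/
def IsFluxProfile (F : FluxData) (σ : ℝ) (V : ℝ → ℝ) : Prop :=
  ∀ x ∈ Ioo (0:ℝ) 1, (x, V x) ∈ fluxRegion F ∧ HasDerivAt V (fluxField F σ x (V x)) x

lemma IsFluxProfile.contDiffOn_slope {F : FluxData} {σ : ℝ} {V : ℝ → ℝ}
    (hV : IsFluxProfile F σ V) : ContDiffOn ℝ 1 (fun x => slopeOf F x (V x)) (Ioo 0 1) := by
  have hVc : ContinuousOn V (Ioo 0 1) := fun x hx =>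
    (hV x hx).2.continuousAt.continuousWithinAt
  have hV1 : ContDiffOn ℝ 1 V (Ioo 0 1) := by
    rw [show (1 : WithTop ℕ∞) = 0 + 1 by norm_num, contDiffOn_succ_iff_deriv_of_isOpen isOpen_Ioo,
      contDiffOn_zero]
    refine ⟨fun x hx => (hV x hx).2.differentiableAt.differentiableWithinAt, by simp, ?_⟩
    have : ContinuousOn (fun x => fluxField F σ x (V x)) (Ioo 0 1) := by
      intro x hx
      exact ContinuousAt.comp_continuousWithinAt (f := fun x => (x, V x))
        (g := fun q : ℝ × ℝ => fluxField F σ q.1 q.2)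
        (contDiffAt_fluxField σ (hV x hx).1).continuousAt (continuousWithinAt_id.prodMk (hVc x hx))
    exact this.congr fun x hx => (hV x hx).2.deriv
  intro x hx
  exact ContDiffAt.comp_contDiffWithinAt (f := fun x => (x, V x))
    (g := fun q : ℝ × ℝ => slopeOf F q.1 q.2) x
    (fluxRegion_nhds_and_contDiffAt (hV x hx).1).2 (contDiffWithinAt_id.prodMk (hV1 x hx))

lemma IsFluxProfile.exists_slope_bound {F : FluxData} {σ C : ℝ} {V : ℝ → ℝ}
    (hV : IsFluxProfile F σ V) (hC0 : 0 < C) (hC : ∀ x ∈ Ioo (0:ℝ) 1, V x ≤ C * (x * (1 - x))) :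
    ∃ C', ∀ x ∈ Ioo (0:ℝ) 1, slopeOf F x (V x) ≤ C' * (x * (1 - x)) := by
  obtain ⟨s₀, c, M, hs₀, hc, -, hbd⟩ := exists_flux_bounds F
  set η := c * s₀ / (2 * C) with hη
  have hη0 : 0 < η := by positivity
  have hηC : C * η < c * s₀ := by
    have : C * η = c * s₀ / 2 := by rw [hη]; field_simp
    rw [this]; linarith [mul_pos hc hs₀]
  have hcpt : IsCompact {x ∈ Icc (0:ℝ) 1 | η ≤ x * (1 - x)} :=
    isCompact_Icc.of_isClosed_subset
      (isClosed_Icc.isClosed_le continuousOn_const (by fun_prop)) fun x hx => hx.1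
  have hsub : {x ∈ Icc (0:ℝ) 1 | η ≤ x * (1 - x)} ⊆ Ioo 0 1 := by
    rintro x ⟨hx, hx'⟩
    have := hη0.trans_le hx'
    exact ⟨hx.1.lt_of_ne fun h => by simp [← h] at this,
      hx.2.lt_of_ne fun h => by simp [h] at this⟩
  obtain ⟨N, hN⟩ := hcpt.exists_bound_of_continuousOn (hV.contDiffOn_slope.continuousOn.mono hsub)
  refine ⟨C / c + |N| / η, fun x hx => ?_⟩
  have hx0 : 0 < x * (1 - x) := mul_pos hx.1 (sub_pos.2 hx.2)
  rw [add_mul]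
  rcases le_or_gt η (x * (1 - x)) with h | h
  · have h1 := (le_abs_self _).trans (hN x ⟨Ioo_subset_Icc_self hx, h⟩)
    have h2 : |N| ≤ |N| / η * (x * (1 - x)) := by
      rw [div_mul_eq_mul_div, le_div_iff₀ hη0]
      exact mul_le_mul_of_nonneg_left h (abs_nonneg N)
    have h3 : 0 ≤ C / c * (x * (1 - x)) := by positivity
    linarith [le_abs_self N]
  · obtain ⟨hs0, hs, e⟩ := slopeOf_spec (hV x hx).1
    have h1 := ((hbd x (Ioo_subset_Icc_self hx)).2 _ hs hs0).1
    rw [e] at h1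
    have h2 := hC x hx
    have h3 : C * (x * (1 - x)) < C * η := mul_lt_mul_of_pos_left h hC0
    have h4 : 0 ≤ |N| / η * (x * (1 - x)) := by positivity
    rcases le_total (slopeOf F x (V x)) s₀ with h5 | h5
    · rw [min_eq_left h5] at h1
      have h6 : slopeOf F x (V x) ≤ C / c * (x * (1 - x)) := by
        rw [div_mul_eq_mul_div, le_div_iff₀ hc]
        linarith
      linarith
    · rw [min_eq_right h5] at h1
      linarith

lemma IsFluxProfile.exists_wave {F : FluxData} {σ C : ℝ} {V : ℝ → ℝ}
    (hV : IsFluxProfile F σ V) (hC0 : 0 < C) (hC : ∀ x ∈ Ioo (0:ℝ) 1, V x ≤ C * (x * (1 - x))) :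
    ∃ u : ℝ → ℝ, IsClassicTW F F.a σ u := by
  obtain ⟨C', hC'⟩ := hV.exists_slope_bound hC0 hC
  have hspec := fun x hx => slopeOf_spec (hV x hx).1
  obtain ⟨u, hu, hu', hbot, htop⟩ := exists_global_trajectory hV.contDiffOn_slope.continuousOn
    (fun x hx => (hspec x hx).1) hC'
  have hderiv : deriv u = fun ξ => slopeOf F (u ξ) (V (u ξ)) := funext fun ξ => (hu' ξ).deriv
  have huc : Continuous u := continuous_iff_continuousAt.2 fun ξ => (hu' ξ).continuousAt
  have hu1 : ContDiff ℝ 1 u := by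
    rw [contDiff_one_iff_deriv, hderiv]
    exact ⟨fun ξ => (hu' ξ).differentiableAt,
      hV.contDiffOn_slope.continuousOn.comp_continuous huc hu⟩
  have hu2 : ContDiff ℝ 2 u := by
    rw [show (2 : WithTop ℕ∞) = 1 + 1 by norm_num, contDiff_succ_iff_deriv, hderiv]
    refine ⟨fun ξ => (hu' ξ).differentiableAt, by simp, ?_⟩
    exact hV.contDiffOn_slope.comp_contDiff hu1 hu
  refine ⟨u, hu2, hu, fun ξ => ?_, hbot, htop, fun ξ => ?_⟩
  · obtain ⟨h0, h1, -⟩ := hspec _ (hu ξ)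
    rw [hderiv]
    refine ⟨h0, ?_⟩
    have := h1.2
    rwa [abs_of_pos h0] at this
  · have h1 : (fun t => F.a (u t) (deriv u t)) = V ∘ u := by
      rw [hderiv]
      exact funext fun t => (hspec _ (hu t)).2.2
    have h2 := (hV (u ξ) (hu ξ)).2.comp ξ (hu' ξ)
    rw [h1, hderiv]
    convert! h2 using 1
    have := (hspec _ (hu ξ)).1.ne'
    simp only at this
    rw [fluxField, sub_mul, div_mul_cancel₀ _ this]

lemma IsBarrier.exists_wave {F : FluxData} {σ C : ℝ} {W : ℝ → ℝ} (hW : IsBarrier F σ W)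
    (hC0 : 0 < C) (hC : ∀ x ∈ Ioo (0:ℝ) 1, W x ≤ C * (x * (1 - x))) :
    ∃ u : ℝ → ℝ, IsClassicTW F F.a σ u := by
  obtain ⟨V, hV⟩ := hW.exists_solution
  have hp : IsFluxProfile F σ V := fun x hx =>
    ⟨fluxRegion_of_le (hW x hx).1 (hV x hx).1 (hV x hx).2.1, (hV x hx).2.2⟩
  exact hp.exists_wave hC0 fun x hx => (hV x hx).2.1.trans (hC x hx)

lemma exists_wave_speed (F : FluxData) : ∃ σ : ℝ, 0 ≤ σ ∧ ∃ u : ℝ → ℝ, IsClassicTW F F.a σ u := by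
  obtain ⟨s₀, c, M, hs₀, hc, hcM, hbd⟩ := exists_flux_bounds F
  obtain ⟨L, hL, hf⟩ := exists_reaction_bound F
  have hM : 0 < M := hc.trans_le hcM
  set K := c * s₀ with hK
  have hK0 : 0 < K := mul_pos hc hs₀
  refine ⟨K + L * M / K + 1, by positivity, ?_⟩
  refine IsBarrier.exists_wave (W := fun x => K * (x * (1 - x))) ?_ hK0 fun x _ => le_rfl
  intro x hx
  have hx' := Ioo_subset_Icc_self hx
  have hx1 : 0 < x * (1 - x) := mul_pos hx.1 (sub_pos.2 hx.2)
  have hx2 : x * (1 - x) ≤ 1 := by nlinarith [hx.1, hx.2]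
  obtain ⟨hs, hb⟩ := hbd x hx'
  have h1 := (hb s₀ hs hs₀).1
  rw [min_self] at h1
  have hWK : K * (x * (1 - x)) ≤ K := by nlinarith
  have hreg : (x, K * (x * (1 - x))) ∈ fluxRegion F :=
    fluxRegion_of_le (w := F.a x s₀) ⟨hx, s₀, hs₀, hs, rfl⟩ (by positivity) (hWK.trans h1)
  refine ⟨hreg, K * (1 - 2 * x), ?_, ?_⟩
  · have h2 := ((hasDerivAt_id x).mul ((hasDerivAt_id x).const_sub 1)).const_mul K
    convert! h2 using 1
    simp only [id]
    ring
  · obtain ⟨hs0, hs1, e⟩ := slopeOf_spec hreg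
    simp only at hs0 hs1 e
    have h2 := (hb _ hs1 hs0).2
    rw [e, min_eq_right] at h2
    · have h3 : F.f x / slopeOf F x (K * (x * (1 - x))) ≤ L * M / K := by
        rw [div_le_div_iff₀ hs0 hK0]
        have h4 : K * (x * (1 - x)) ≤ slopeOf F x (K * (x * (1 - x))) * M := (div_le_iff₀ hM).1 h2
        calc F.f x * K ≤ L * (x * (1 - x)) * K := mul_le_mul_of_nonneg_right (hf x hx') hK0.le
          _ = L * (K * (x * (1 - x))) := by ring
          _ ≤ L * (slopeOf F x (K * (x * (1 - x))) * M) := mul_le_mul_of_nonneg_left h4 hL.le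
          _ = _ := by ring
      rw [fluxField]
      nlinarith [hx.1]
    · rw [div_le_iff₀ hM]
      nlinarith

lemma IsClassicTW.exists_deriv_lt {F : FluxData} {b : ℝ → ℝ → ℝ} {σ η : ℝ} {u : ℝ → ℝ}
    (hu : IsClassicTW F b σ u) (hη : 0 < η) (ξ : ℝ) :
    ∃ t ∈ Icc ξ (ξ + 1 / η), deriv u t < η := by
  obtain ⟨hu2, hu01, -⟩ := hu
  have hle : ξ ≤ ξ + 1 / η := le_add_of_nonneg_right (by positivity)
  by_contra! hcon
  have h := (convex_Icc ξ (ξ + 1 / η)).mul_sub_le_image_sub_of_le_deriv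
    hu2.continuous.continuousOn (hu2.differentiable (by norm_num)).differentiableOn
    (fun t ht => hcon t (interior_subset ht)) ξ (left_mem_Icc.2 hle) _ (right_mem_Icc.2 hle) hle
  rw [add_sub_cancel_left, mul_one_div_cancel hη.ne'] at h
  linarith [(hu01 ξ).1, (hu01 (ξ + 1 / η)).2]

lemma IsClassicTW.strictMono {F : FluxData} {b : ℝ → ℝ → ℝ} {σ : ℝ} {u : ℝ → ℝ}
    (hu : IsClassicTW F b σ u) : StrictMono u :=
  strictMono_of_deriv_pos fun ξ => (hu.2.2.1 ξ).1

lemma IsClassicTW.surjOn {F : FluxData} {b : ℝ → ℝ → ℝ} {σ : ℝ} {u : ℝ → ℝ}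
    (hu : IsClassicTW F b σ u) : SurjOn u univ (Ioo 0 1) := by
  obtain ⟨hu2, -, -, hbot, htop, -⟩ := hu
  intro x hx
  obtain ⟨ξ₁, h₁⟩ := (hbot.eventually (gt_mem_nhds hx.1)).exists
  obtain ⟨ξ₂, h₂⟩ := (htop.eventually (lt_mem_nhds hx.2)).exists
  obtain ⟨ξ, -, h⟩ := intermediate_value_uIcc (hu2.continuous.continuousOn (s := uIcc ξ₁ ξ₂))
    (Icc_subset_uIcc ⟨h₁.le, h₂.le⟩)
  exact ⟨ξ, trivial, h⟩

/-- The flux of a wave as a function of its value solves the first-order equation. -/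
lemma IsClassicTW.exists_profile {F : FluxData} {σ : ℝ} {u : ℝ → ℝ}
    (hu : IsClassicTW F F.a σ u) :
    ∃ V, IsFluxProfile F σ V ∧ ∀ ξ, slopeOf F (u ξ) (V (u ξ)) = deriv u ξ := by
  have hmono := hu.strictMono
  have hsurj := hu.surjOn
  obtain ⟨hu2, hu01, hu', -, -, heq⟩ := hu
  obtain ⟨ψ, hψ, hψu⟩ := exists_differentiable_inverse isOpen_univ isOpen_Ioo
    ⟨fun ξ _ => hu01 ξ, hmono.injective.injOn, hsurj⟩ (hmono.strictMonoOn univ)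
    (fun ξ _ => (hu2.differentiable (by norm_num) ξ).hasDerivAt) fun ξ _ => (hu' ξ).1.ne'
  have hs : ∀ ξ, deriv u ξ ∈ slopes F (u ξ) := fun ξ =>
    ⟨Ioo_subset_Icc_self (hu01 ξ), by simpa only [abs_of_pos (hu' ξ).1] using (hu' ξ).2⟩
  refine ⟨fun x => F.a (u (ψ x)) (deriv u (ψ x)), fun x hx => ?_, fun ξ => ?_⟩
  · obtain ⟨-, hx1, hx2⟩ := hψ x hx
    have h1 := (heq (ψ x)).comp x hx2
    have h3 : slopeOf F x (F.a (u (ψ x)) (deriv u (ψ x))) = deriv u (ψ x) := by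
      conv_lhs => rw [← hx1]
      rw [hx1, ← hx1, hψu _ trivial]
      exact slopeOf_flux (hs _)
    refine ⟨⟨hx, deriv u (ψ x), (hu' _).1, ?_, ?_⟩, ?_⟩
    · simpa only [hx1] using hs (ψ x)
    · simp only [hx1]
    · convert! h1 using 1
      rw [fluxField, h3, hx1]
      have := (hu' (ψ x)).1.ne'
      field_simp
  · simp only [hψu ξ trivial]
    exact slopeOf_flux (hs ξ)

lemma IsFluxProfile.antitoneOn_sub_mul {F : FluxData} {σ : ℝ} {V : ℝ → ℝ}
    (hV : IsFluxProfile F σ V) : AntitoneOn (fun x => V x - σ * x) (Ioo 0 1) := by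
  have hd : ∀ x ∈ Ioo (0:ℝ) 1,
      HasDerivAt (fun x => V x - σ * x) (fluxField F σ x (V x) - σ * 1) x := fun x hx =>
    (hV x hx).2.sub ((hasDerivAt_id x).const_mul σ)
  refine antitoneOn_of_deriv_nonpos (convex_Ioo 0 1)
    (fun x hx => (hd x hx).continuousAt.continuousWithinAt)
    (fun x hx => (hd x (interior_subset hx)).differentiableAt.differentiableWithinAt) ?_
  intro x hx
  rw [interior_Ioo] at hx
  rw [(hd x hx).deriv, fluxField]
  have := div_nonneg (F.f_pos x hx).le (slopeOf_spec (hV x hx).1).1.le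
  linarith

/-- A bound from below on the flux gives a bound from below on the slope. -/
lemma exists_slope_ge (F : FluxData) {d : ℝ} (hd : 0 < d) : ∃ η > 0, ∀ x v,
    (x, v) ∈ fluxRegion F → d ≤ v → η ≤ slopeOf F x v := by
  obtain ⟨s₀, c, M, hs₀, hc, hcM, hbd⟩ := exists_flux_bounds F
  have hM : 0 < M := hc.trans_le hcM
  refine ⟨min s₀ (d / M), lt_min hs₀ (by positivity), fun x v h hdv => ?_⟩
  obtain ⟨h0, hs, e⟩ := slopeOf_spec h
  simp only at h0 hs e
  have h1 := ((hbd x (Ioo_subset_Icc_self h.1)).2 _ hs h0).2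
  rw [e] at h1
  exact (min_le_min_left _ (div_le_div_of_nonneg_right hdv hM.le)).trans h1

lemma IsClassicTW.profile_le_mul {F : FluxData} {σ : ℝ} {u V : ℝ → ℝ}
    (hu : IsClassicTW F F.a σ u) (hσ : 0 ≤ σ) (hV : IsFluxProfile F σ V)
    (huV : ∀ ξ, slopeOf F (u ξ) (V (u ξ)) = deriv u ξ) : ∀ x ∈ Ioo (0:ℝ) 1, V x ≤ σ * x := by
  intro x hx
  by_contra! hcon
  obtain ⟨η, hη, h⟩ := exists_slope_ge F (sub_pos.2 hcon)
  obtain ⟨ξ, -, rfl⟩ := hu.surjOn hx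
  obtain ⟨t, ht, htη⟩ := hu.exists_deriv_lt hη (ξ - 1 / η)
  rw [sub_add_cancel] at ht
  have h1 := hV.antitoneOn_sub_mul (hu.2.1 t) hx (hu.strictMono.monotone ht.2)
  have h2 := h (u t) (V (u t)) (hV _ (hu.2.1 t)).1 (by nlinarith [(hu.2.1 t).1])
  rw [huV] at h2
  linarith

lemma IsClassicTW.exists_profile_le_mul_one_sub {F : FluxData} {σ : ℝ} {u V : ℝ → ℝ}
    (hu : IsClassicTW F F.a σ u) (hσ : 0 ≤ σ) (hV : IsFluxProfile F σ V)
    (huV : ∀ ξ, slopeOf F (u ξ) (V (u ξ)) = deriv u ξ) :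
    ∃ C, ∀ x ∈ Ioo (0:ℝ) 1, V x ≤ C * (1 - x) := by
  obtain ⟨s₀, c, M, hs₀, hc, hcM, hbd⟩ := exists_flux_bounds F
  obtain ⟨L, hL, hf⟩ := exists_reaction_bound F
  have hM : 0 < M := hc.trans_le hcM
  set C := L / s₀ + L * M + 1 with hC
  have hC1 : 1 ≤ C := by rw [hC]; linarith [div_pos hL hs₀, mul_pos hL hM]
  have hfield : ∀ x ∈ Ioo (0:ℝ) 1, C * (1 - x) ≤ V x → -C < fluxField F σ x (V x) := by
    intro x hx hCV
    have hx1 : 0 < 1 - x := sub_pos.2 hx.2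
    obtain ⟨h0, hs, e⟩ := slopeOf_spec (hV x hx).1
    simp only at h0 hs e
    have h1 := ((hbd x (Ioo_subset_Icc_self hx)).2 _ hs h0).2
    rw [e] at h1
    have h2 : F.f x ≤ L * (1 - x) :=
      (hf x (Ioo_subset_Icc_self hx)).trans (by nlinarith [hx.1, mul_pos hL hx1])
    suffices h3 : F.f x / slopeOf F x (V x) < C by rw [fluxField]; linarith
    rw [div_lt_iff₀ h0]
    rcases min_le_iff.1 h1 with h4 | h4
    · have h5 : L ≤ L / s₀ * slopeOf F x (V x) := by
        rw [div_mul_eq_mul_div, le_div_iff₀ hs₀]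
        exact mul_le_mul_of_nonneg_left h4 hL.le
      have h6 : 0 < (L * M + 1) * slopeOf F x (V x) := by positivity
      nlinarith [hx.1]
    · rw [div_le_iff₀ hM] at h4
      have h5 : 1 - x ≤ V x := by nlinarith
      have h6 : L * (1 - x) ≤ L * M * slopeOf F x (V x) := by nlinarith
      have h7 : 0 < (L / s₀ + 1) * slopeOf F x (V x) := by positivity
      nlinarith
  refine ⟨C, fun x hx => ?_⟩
  by_contra! hcon
  obtain ⟨η, hη, h⟩ := exists_slope_ge F (sub_pos.2 hcon)
  obtain ⟨ξ, -, rfl⟩ := hu.surjOn hx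
  obtain ⟨t, ht, htη⟩ := hu.exists_deriv_lt hη ξ
  have hle : u ξ ≤ u t := hu.strictMono.monotone ht.1
  have hsub : Icc (u ξ) (u t) ⊆ Ioo 0 1 := ordConnected_Ioo.out hx (hu.2.1 t)
  have key := image_le_of_deriv_right_lt_deriv_boundary' (a := u ξ) (b := u t)
    (f := fun x => C * (1 - x) + (V (u ξ) - C * (1 - u ξ))) (f' := fun _ => -C) (B := V)
    (B' := fun x => fluxField F σ x (V x))
    (by fun_prop)
    (fun x _ => by
      have h := (((hasDerivAt_id x).const_sub 1).const_mul C).add_const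
        (V (u ξ) - C * (1 - u ξ))
      simpa using h.hasDerivWithinAt)
    (by linarith) (fun x hx => (hV x (hsub hx)).2.continuousAt.continuousWithinAt)
    (fun x hx => (hV x (hsub (Ico_subset_Icc_self hx))).2.hasDerivWithinAt)
    (fun x hx hxe => hfield x (hsub (Ico_subset_Icc_self hx)) (by linarith))
    (right_mem_Icc.2 hle)
  have h2 := h (u t) (V (u t)) (hV _ (hu.2.1 t)).1 (by nlinarith [(hu.2.1 t).2])
  rw [huV] at h2
  linarith

/-- The set of nonnegative wave speeds is upward closed. -/
lemma IsClassicTW.exists_of_lt {F : FluxData} {σ₁ σ : ℝ} {u : ℝ → ℝ}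
    (hu : IsClassicTW F F.a σ₁ u) (h₁ : 0 ≤ σ₁) (hσ : σ₁ < σ) :
    ∃ u : ℝ → ℝ, IsClassicTW F F.a σ u := by
  obtain ⟨V, hV, huV⟩ := hu.exists_profile
  have hV0 := hu.profile_le_mul h₁ hV huV
  obtain ⟨C, hC⟩ := hu.exists_profile_le_mul_one_sub h₁ hV huV
  have hW : IsBarrier F σ V := fun x hx =>
    ⟨(hV x hx).1, _, (hV x hx).2, sub_lt_sub_right hσ _⟩
  refine hW.exists_wave (C := 2 * (σ₁ + |C| + 1)) (by positivity) fun x hx => ?_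
  have h2 := hV0 x hx
  have h3 := hC x hx
  have hx0 := hx.1
  have hx1 : 0 < 1 - x := sub_pos.2 hx.2
  have hxx : 0 < x * (1 - x) := mul_pos hx0 hx1
  rcases le_total x (1 / 2) with h | h
  · have h4 : σ₁ * x ≤ 2 * σ₁ * (x * (1 - x)) := by
      nlinarith [mul_nonneg (mul_nonneg h₁ hx0.le) (by linarith : 0 ≤ 1 - 2 * x)]
    have h5 : 0 ≤ 2 * (|C| + 1) * (x * (1 - x)) := by positivity
    linarith
  · have h4 : C * (1 - x) ≤ |C| * (1 - x) := mul_le_mul_of_nonneg_right (le_abs_self C) hx1.le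
    have h5 : |C| * (1 - x) ≤ 2 * |C| * (x * (1 - x)) := by
      nlinarith [mul_nonneg (mul_nonneg (abs_nonneg C) hx1.le) (by linarith : 0 ≤ 2 * x - 1)]
    have h6 : 0 ≤ 2 * (σ₁ + 1) * (x * (1 - x)) := by positivity
    linarith

/-- Wave speeds are bounded away from zero. -/
lemma exists_pos_le_wave_speed (F : FluxData) : ∃ σ₀ : ℝ, 0 < σ₀ ∧
    ∀ σ u, 0 ≤ σ → IsClassicTW F F.a σ u → σ₀ ≤ σ := by
  obtain ⟨s₀, c, M, hs₀, hc, hcM, hbd⟩ := exists_flux_bounds F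
  have hsub : Icc (1 / 4 : ℝ) (3 / 4) ⊆ Ioo 0 1 := fun x hx =>
    ⟨by linarith [hx.1], by linarith [hx.2]⟩
  obtain ⟨t₁, ht₁, hmin⟩ := isCompact_Icc.exists_isMinOn
    (nonempty_Icc.2 (by norm_num : (1 / 4 : ℝ) ≤ 3 / 4))
    (F.f_C1.continuousOn.mono (hsub.trans Ioo_subset_Icc_self))
  have hm : 0 < F.f t₁ := F.f_pos t₁ (hsub ht₁)
  refine ⟨min (c * s₀) (min 1 (c * F.f t₁ / 2)),
    lt_min (mul_pos hc hs₀) (lt_min one_pos (by positivity)), fun σ u hσ hu => ?_⟩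
  by_contra! hcon
  obtain ⟨hσ1, hσ2⟩ := lt_min_iff.1 hcon
  obtain ⟨hσ2, hσ3⟩ := lt_min_iff.1 hσ2
  obtain ⟨V, hV, huV⟩ := hu.exists_profile
  have hVσ := hu.profile_le_mul hσ hV huV
  have hpos : ∀ x ∈ Ioo (0:ℝ) 1, 0 < V x := fun x hx => fluxRegion_snd_pos (hV x hx).1
  have hl : (1 / 4 : ℝ) ∈ Icc (1 / 4 : ℝ) (3 / 4) := left_mem_Icc.2 (by norm_num)
  have hr : (3 / 4 : ℝ) ∈ Icc (1 / 4 : ℝ) (3 / 4) := right_mem_Icc.2 (by norm_num)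
  have hV1 := hVσ _ (hsub hl)
  have hσ0 : 0 < σ := by linarith [hpos _ (hsub hl)]
  have hd : ∀ x ∈ Icc (1 / 4 : ℝ) (3 / 4), deriv V x ≤ σ - c * F.f t₁ / σ := by
    intro x hx
    have hx' := hsub hx
    obtain ⟨h0, hs, e⟩ := slopeOf_spec (hV x hx').1
    simp only at h0 hs e
    have h1 := ((hbd x (Ioo_subset_Icc_self hx')).2 _ hs h0).1
    rw [e] at h1
    have h2 := hVσ x hx'
    have h3 : V x ≤ σ := h2.trans (by nlinarith [hx'.2])
    have h4 : c * slopeOf F x (V x) ≤ σ := by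
      rcases le_total (slopeOf F x (V x)) s₀ with h | h
      · rw [min_eq_left h] at h1
        linarith
      · rw [min_eq_right h] at h1
        linarith
    have h5 : F.f t₁ ≤ F.f x := hmin hx
    rw [(hV x hx').2.deriv, fluxField]
    refine sub_le_sub_left ?_ σ
    rw [div_le_div_iff₀ hσ0 h0]
    calc c * F.f t₁ * slopeOf F x (V x) = F.f t₁ * (c * slopeOf F x (V x)) := by ring
      _ ≤ F.f t₁ * σ := mul_le_mul_of_nonneg_left h4 hm.le
      _ ≤ F.f x * σ := mul_le_mul_of_nonneg_right h5 hσ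
  have h := (convex_Icc (1 / 4 : ℝ) (3 / 4)).image_sub_le_mul_sub_of_deriv_le
    (fun x hx => (hV x (hsub hx)).2.continuousAt.continuousWithinAt)
    (fun x hx => (hV x (hsub (interior_subset hx))).2.differentiableAt.differentiableWithinAt)
    (fun x hx => hd x (interior_subset hx)) _ hl _ hr (by norm_num)
  have h6 : 2 < c * F.f t₁ / σ := by
    rw [lt_div_iff₀ hσ0]
    linarith
  have h7 := hpos _ (hsub hr)
  linarith

theorem stmt0 (F : FluxData) :
    ∃ σr : ℝ, 0 < σr ∧
      (∀ σ : ℝ, σr < σ → ∃ u : ℝ → ℝ, IsClassicTW F F.a σ u) ∧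
      (∀ σ : ℝ, 0 ≤ σ → σ < σr → ¬ ∃ u : ℝ → ℝ, IsClassicTW F F.a σ u) := by
  obtain ⟨σ₀, h₀, hlow⟩ := exists_pos_le_wave_speed F
  set S : Set ℝ := {σ | 0 ≤ σ ∧ ∃ u : ℝ → ℝ, IsClassicTW F F.a σ u}
  have hne : S.Nonempty := exists_wave_speed F
  have hbound : ∀ σ ∈ S, σ₀ ≤ σ := by
    rintro σ ⟨hσ, u, hu⟩
    exact hlow σ u hσ hu
  refine ⟨sInf S, h₀.trans_le (le_csInf hne hbound), fun σ hσ => ?_, fun σ h0 hσ h => ?_⟩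
  · obtain ⟨σ₁, ⟨h₁, u, hu⟩, hlt⟩ := exists_lt_of_csInf_lt hne hσ
    exact hu.exists_of_lt h₁ hlt
  · exact notMem_of_lt_csInf hσ ⟨σ₀, hbound⟩ ⟨h0, h⟩
end
end

section
/- For every σ ≥ 0 there exist α ∈ [0,1) and a function V : (α,1] → ℝ, continuous on (α,1] and C¹ on (α,1), such that V(1) = 0 and, for all u ∈ (α,1): V(u) > 0, (u,V(u)) ∈ 𝒟, and V'(u) = σ − f(u)/g(u,V(u)). Moreover such a function is unique: if V₁ and V₂ both have these properties on a common interval (ε,1] with ε ∈ [0,1), then V₁(u) = V₂(u) for all u ∈ (ε,1]. -/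
open Set Filter Topology
open scoped ENNReal

noncomputable section

/-- Pointwise limits of functions with uniformly bounded derivatives are continuous. -/
theorem continuousOn_of_tendsto_of_deriv_bound {a b L : ℝ} {v h : ℕ → ℝ → ℝ} {V : ℝ → ℝ}
    (hc : ∀ n, ContinuousOn (v n) (Icc a b))
    (hd : ∀ n, ∀ t ∈ Ioo a b, HasDerivAt (v n) (h n t) t)
    (hL : ∀ n, ∀ t ∈ Ioo a b, |h n t| ≤ L)
    (hv : ∀ t ∈ Icc a b, Tendsto (fun n => v n t) atTop (𝓝 (V t))) :
    ContinuousOn V (Icc a b) := by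
  have hlip : ∀ x ∈ Icc a b, ∀ y ∈ Icc a b, x ≤ y → |V y - V x| ≤ L * (y - x) := by
    intro x hx y hy hxy
    refine le_of_tendsto (((hv y hy).sub (hv x hx)).abs) (Eventually.of_forall fun n => ?_)
    have hdiff : DifferentiableOn ℝ (v n) (interior (Icc a b)) := by
      rw [interior_Icc]
      exact fun t ht => (hd n t ht).differentiableAt.differentiableWithinAt
    have h1 := (convex_Icc a b).image_sub_le_mul_sub_of_deriv_le (hc n) hdiff (C := L)
      (by
        rw [interior_Icc]
        intro t ht
        rw [(hd n t ht).deriv]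
        exact (abs_le.1 (hL n t ht)).2) x hx y hy hxy
    have h2 := (convex_Icc a b).mul_sub_le_image_sub_of_le_deriv (hc n) hdiff (C := -L)
      (by
        rw [interior_Icc]
        intro t ht
        rw [(hd n t ht).deriv]
        exact (abs_le.1 (hL n t ht)).1) x hx y hy hxy
    rw [abs_le]
    constructor <;> linarith
  have hLip : LipschitzOnWith (Real.toNNReal L) V (Icc a b) := by
    refine LipschitzOnWith.of_dist_le_mul fun x hx y hy => ?_
    rw [Real.dist_eq, Real.dist_eq]
    refine le_trans ?_ (mul_le_mul_of_nonneg_right (Real.le_coe_toNNReal L) (abs_nonneg _))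
    rcases le_total x y with hxy | hxy
    · rw [abs_sub_comm, abs_sub_comm x y, abs_of_nonneg (sub_nonneg.2 hxy)]
      exact hlip x hx y hy hxy
    · rw [abs_of_nonneg (sub_nonneg.2 hxy)]
      exact hlip y hy x hx hxy
  exact hLip.continuousOn

/-- If functions and their continuous, uniformly bounded derivatives converge pointwise to `V` and
to a continuous `H`, then `H` is the derivative of `V`. -/
theorem hasDerivAt_of_tendsto_of_deriv_bound {a b L : ℝ} {v h : ℕ → ℝ → ℝ} {V H : ℝ → ℝ}
    (hc : ∀ n, ContinuousOn (v n) (Icc a b))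
    (hd : ∀ n, ∀ t ∈ Ioo a b, HasDerivAt (v n) (h n t) t)
    (hh : ∀ n, ContinuousOn (h n) (Icc a b))
    (hL : ∀ n, ∀ t ∈ Icc a b, |h n t| ≤ L)
    (hv : ∀ t ∈ Icc a b, Tendsto (fun n => v n t) atTop (𝓝 (V t)))
    (hhH : ∀ t ∈ Icc a b, Tendsto (fun n => h n t) atTop (𝓝 (H t)))
    (hH : ContinuousOn H (Icc a b)) {t : ℝ} (ht : t ∈ Ioo a b) :
    HasDerivAt V (H t) t := by
  have hab : a ≤ b := (ht.1.trans ht.2).le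
  have key : ∀ x ∈ Icc a b, V x = V a + ∫ τ in a..x, H τ := by
    intro x hx
    have hsub : Icc a x ⊆ Icc a b := Icc_subset_Icc_right hx.2
    have h1 : ∀ n, ∫ τ in a..x, h n τ = v n x - v n a := fun n =>
      intervalIntegral.integral_eq_sub_of_hasDerivAt_of_le hx.1 ((hc n).mono hsub)
        (fun y hy => hd n y ⟨hy.1, hy.2.trans_le hx.2⟩)
        (((hh n).mono hsub).intervalIntegrable_of_Icc hx.1)
    have huIoc : ∀ τ ∈ uIoc a x, τ ∈ Icc a b := by
      intro τ hτ
      rw [uIoc_of_le hx.1] at hτ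
      exact ⟨hτ.1.le, hτ.2.trans hx.2⟩
    have h2 : Tendsto (fun n => ∫ τ in a..x, h n τ) atTop (𝓝 (∫ τ in a..x, H τ)) := by
      refine intervalIntegral.tendsto_integral_filter_of_dominated_convergence (fun _ => L)
        (Eventually.of_forall fun n => ?_)
        (Eventually.of_forall fun n => Eventually.of_forall fun τ hτ => hL n τ (huIoc τ hτ))
        intervalIntegrable_const
        (Eventually.of_forall fun τ hτ => hhH τ (huIoc τ hτ))
      exact ((hh n).mono huIoc).aestronglyMeasurable measurableSet_uIoc
    have h3 : Tendsto (fun n => ∫ τ in a..x, h n τ) atTop (𝓝 (V x - V a)) := by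
      simp only [h1]
      exact (hv x hx).sub (hv a ⟨le_rfl, hab⟩)
    have := tendsto_nhds_unique h2 h3
    linarith
  have hnhds : Icc a b ∈ 𝓝 t := Icc_mem_nhds ht.1 ht.2
  have hder : HasDerivAt (fun x => V a + ∫ τ in a..x, H τ) (H t) t := by
    refine (intervalIntegral.integral_hasDerivAt_right ?_ ?_ (hH.continuousAt hnhds)).const_add _
    · exact (hH.mono (Icc_subset_Icc_right ht.2.le)).intervalIntegrable_of_Icc ht.1.le
    · exact ⟨Icc a b, hnhds, hH.aestronglyMeasurable measurableSet_Icc⟩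
  exact hder.congr_of_eventuallyEq (Filter.mem_of_superset hnhds key)

/-- A continuous function that starts nonpositive and does not increase where it is positive stays
nonpositive. -/
theorem nonpos_of_deriv_nonpos_where_pos {d : ℝ → ℝ} {a b : ℝ} (hc : ContinuousOn d (Icc a b))
    (ha : d a ≤ 0) (hd : ∀ t ∈ Ioo a b, 0 < d t → ∃ d', HasDerivAt d d' t ∧ d' ≤ 0) :
    ∀ t ∈ Icc a b, d t ≤ 0 := by
  intro t ht
  by_contra! hpos
  set S := {x ∈ Icc a t | d x ≤ 0} with hS
  have hct : ContinuousOn d (Icc a t) := hc.mono (Icc_subset_Icc_right ht.2)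
  have hScl : IsClosed S := hct.preimage_isClosed_of_isClosed isClosed_Icc isClosed_Iic
  have hSne : S.Nonempty := ⟨a, ⟨le_rfl, ht.1⟩, ha⟩
  have hSb : BddAbove S := ⟨t, fun x hx => hx.1.2⟩
  obtain ⟨hsI, hs0⟩ := hScl.csSup_mem hSne hSb
  set s := sSup S
  have hst : s < t := hsI.2.lt_of_ne fun h => by rw [h] at hs0; linarith
  have hp : ∀ x ∈ Ioo s t, 0 < d x := by
    intro x hx
    by_contra! hx0
    exact (le_csSup hSb (show x ∈ S from ⟨⟨hsI.1.trans hx.1.le, hx.2.le⟩, hx0⟩)).not_gt hx.1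
  have hder : ∀ x ∈ Ioo s t, ∃ d', HasDerivAt d d' x ∧ d' ≤ 0 := fun x hx =>
    hd x ⟨hsI.1.trans_lt hx.1, hx.2.trans_le ht.2⟩ (hp x hx)
  have hanti : AntitoneOn d (Icc s t) := by
    refine antitoneOn_of_deriv_nonpos (convex_Icc s t) (hct.mono (Icc_subset_Icc_left hsI.1)) ?_ ?_
    · rw [interior_Icc]
      intro x hx
      obtain ⟨d', h, -⟩ := hder x hx
      exact h.differentiableAt.differentiableWithinAt
    · rw [interior_Icc]
      intro x hx
      obtain ⟨d', h, h'⟩ := hder x hx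
      rwa [h.deriv]
  have := hanti ⟨le_rfl, hst.le⟩ ⟨hst.le, le_rfl⟩ hst.le
  linarith

/-- Global solvability of a scalar initial value problem with a bounded right-hand side that is
Lipschitz in the state variable. -/
theorem exists_solution_of_lipschitz_of_bounded {Φ : ℝ → ℝ → ℝ} {T L K x₀ : ℝ} (hT : 0 ≤ T)
    (hlip : ∀ t ∈ Icc 0 T, ∀ x y, |Φ t x - Φ t y| ≤ K * |x - y|)
    (hcont : ∀ x, ContinuousOn (fun t => Φ t x) (Icc 0 T))
    (hbd : ∀ t ∈ Icc 0 T, ∀ x, |Φ t x| ≤ L) :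
    ∃ v : ℝ → ℝ, v 0 = x₀ ∧ ContinuousOn v (Icc 0 T) ∧
      ∀ t ∈ Ioo 0 T, HasDerivAt v (Φ t (v t)) t := by
  have hL : 0 ≤ L := (abs_nonneg _).trans (hbd 0 ⟨le_rfl, hT⟩ 0)
  have hP : IsPicardLindelof Φ (tmin := 0) (tmax := T) ⟨0, le_rfl, hT⟩ x₀
      (Real.toNNReal (L * T)) 0 (Real.toNNReal L) (Real.toNNReal K) := by
    refine ⟨fun t ht => ?_, fun x _ => hcont x, fun t ht x _ => ?_, ?_⟩
    · refine LipschitzOnWith.of_dist_le_mul fun x _ y _ => ?_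
      rw [Real.dist_eq, Real.dist_eq]
      exact (hlip t ht x y).trans
        (mul_le_mul_of_nonneg_right (Real.le_coe_toNNReal K) (abs_nonneg _))
    · rw [Real.norm_eq_abs, Real.coe_toNNReal L hL]
      exact hbd t ht x
    · rw [Real.coe_toNNReal L hL, Real.coe_toNNReal _ (mul_nonneg hL hT)]
      simp [hT]
  obtain ⟨v, hv0, hv⟩ := hP.exists_eq_forall_mem_Icc_hasDerivWithinAt₀
  refine ⟨v, hv0, fun t ht => (hv t ht).continuousWithinAt, fun t ht => ?_⟩
  exact (hv t (Ioo_subset_Icc_self ht)).hasDerivAt (Icc_mem_nhds ht.1 ht.2)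

/-- `G t` is, for `t ∈ I`, increasing and bi-Lipschitz on `S` with constants `p` and `q`,
vanishes at `0`, and depends continuously on `t`. -/
structure IsBiLipschitzFamily (G : ℝ → ℝ → ℝ) (I S : Set ℝ) (p q : ℝ) : Prop where
  pos : 0 < p
  le : p ≤ q
  zero : ∀ t ∈ I, G t 0 = 0
  cont : ∀ v ∈ S, ContinuousOn (fun t => G t v) I
  lower : ∀ t ∈ I, ∀ v ∈ S, ∀ w ∈ S, v ≤ w → p * (w - v) ≤ G t w - G t v
  upper : ∀ t ∈ I, ∀ v ∈ S, ∀ w ∈ S, v ≤ w → G t w - G t v ≤ q * (w - v)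

namespace IsBiLipschitzFamily

variable {G : ℝ → ℝ → ℝ} {I S : Set ℝ} {p q : ℝ}

theorem mono_left (h : IsBiLipschitzFamily G I S p q) {J : Set ℝ} (hJ : J ⊆ I) :
    IsBiLipschitzFamily G J S p q :=
  ⟨h.pos, h.le, fun t ht => h.zero t (hJ ht), fun v hv => (h.cont v hv).mono hJ,
    fun t ht => h.lower t (hJ ht), fun t ht => h.upper t (hJ ht)⟩

theorem mul_le (h : IsBiLipschitzFamily G I (Ici 0) p q) {t v : ℝ} (ht : t ∈ I) (hv : 0 ≤ v) :
    p * v ≤ G t v := by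
  have := h.lower t ht 0 (mem_Ici.2 le_rfl) v hv hv
  rw [h.zero t ht] at this
  linarith

theorem le_mul (h : IsBiLipschitzFamily G I (Ici 0) p q) {t v : ℝ} (ht : t ∈ I) (hv : 0 ≤ v) :
    G t v ≤ q * v := by
  have := h.upper t ht 0 (mem_Ici.2 le_rfl) v hv hv
  rw [h.zero t ht] at this
  linarith

theorem apply_pos (h : IsBiLipschitzFamily G I (Ici 0) p q) {t v : ℝ} (ht : t ∈ I) (hv : 0 < v) :
    0 < G t v :=
  (mul_pos h.pos hv).trans_le (h.mul_le ht hv.le)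

theorem apply_mono (h : IsBiLipschitzFamily G I (Ici 0) p q) {t v w : ℝ} (ht : t ∈ I)
    (hv : 0 ≤ v) (hvw : v ≤ w) : G t v ≤ G t w := by
  have := h.lower t ht v hv w (hv.trans hvw) hvw
  have := mul_nonneg h.pos.le (sub_nonneg.2 hvw)
  linarith

theorem abs_sub_le (h : IsBiLipschitzFamily G I S p q) {t v w : ℝ} (ht : t ∈ I)
    (hv : v ∈ S) (hw : w ∈ S) : |G t v - G t w| ≤ q * |v - w| := by
  rcases le_total v w with hvw | hvw
  · have h1 := h.lower t ht v hv w hw hvw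
    have h2 := h.upper t ht v hv w hw hvw
    have := mul_nonneg h.pos.le (sub_nonneg.2 hvw)
    rw [abs_sub_comm, abs_sub_comm v w, abs_of_nonneg (by linarith), abs_of_nonneg (by linarith)]
    exact h2
  · have h1 := h.lower t ht w hw v hv hvw
    have h2 := h.upper t ht w hw v hv hvw
    have := mul_nonneg h.pos.le (sub_nonneg.2 hvw)
    rw [abs_of_nonneg (by linarith), abs_of_nonneg (by linarith)]
    exact h2

theorem continuousOn_prod (h : IsBiLipschitzFamily G I S p q) :
    ContinuousOn (fun z : ℝ × ℝ => G z.1 z.2) (I ×ˢ S) := by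
  refine continuousOn_prod_of_continuousOn_lipschitzOnWith' _ (Real.toNNReal q) ?_ h.cont
  intro t ht
  refine LipschitzOnWith.of_dist_le_mul fun v hv w hw => ?_
  rw [Real.dist_eq, Real.dist_eq, Real.coe_toNNReal q (h.pos.le.trans h.le)]
  exact h.abs_sub_le ht hv hw

/-- A family on `[0, v₀]` extends to `[0, ∞)` with slope `p` beyond `v₀`. -/
theorem extend {v₀ : ℝ} (hv₀ : 0 ≤ v₀) (h : IsBiLipschitzFamily G I (Icc 0 v₀) p q) :
    IsBiLipschitzFamily (fun t v => G t (min v v₀) + p * (v - min v v₀)) I (Ici 0) p q := by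
  have hmem : ∀ v ∈ Ici (0 : ℝ), min v v₀ ∈ Icc 0 v₀ := fun v hv =>
    ⟨le_min hv hv₀, min_le_right _ _⟩
  have hstep : ∀ v w : ℝ, v ≤ w → min v v₀ ≤ min w v₀ ∧ min w v₀ - min v v₀ ≤ w - v := by
    intro v w hvw
    refine ⟨min_le_min_right _ hvw, ?_⟩
    rcases le_total v v₀ with h1 | h1 <;> rcases le_total w v₀ with h2 | h2 <;>
      simp only [min_eq_left, min_eq_right, h1, h2] <;> linarith
  refine ⟨h.pos, h.le, fun t ht => ?_, fun v hv => ?_, fun t ht v hv w hw hvw => ?_,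
    fun t ht v hv w hw hvw => ?_⟩
  · simp [min_eq_left hv₀, h.zero t ht]
  · exact (h.cont _ (hmem v hv)).add continuousOn_const
  · have := h.lower t ht _ (hmem v hv) _ (hmem w hw) (hstep v w hvw).1
    linarith
  · have h1 := h.upper t ht _ (hmem v hv) _ (hmem w hw) (hstep v w hvw).1
    have h2 := mul_nonneg (sub_nonneg.2 h.le) (sub_nonneg.2 (hstep v w hvw).2)
    linarith

end IsBiLipschitzFamily

/-- Solution on `[0, T]` of `dv/dt = (f + kδ) / G(t, v) - σ` that starts at `δ` and stays above it. -/
structure IsRegularizedSolution (G : ℝ → ℝ → ℝ) (f : ℝ → ℝ) (σ k T δ : ℝ) (v : ℝ → ℝ) : Prop where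
  zero : v 0 = δ
  cont : ContinuousOn v (Icc 0 T)
  ge : ∀ t ∈ Icc 0 T, δ ≤ v t
  deriv : ∀ t ∈ Ioo 0 T, HasDerivAt v ((f t + k * δ) / G t (v t) - σ) t

section Regularized

variable {G : ℝ → ℝ → ℝ} {f : ℝ → ℝ} {T p q σ : ℝ}

theorem IsBiLipschitzFamily.exists_isRegularizedSolution
    (h : IsBiLipschitzFamily G (Icc 0 T) (Ici 0) p q) (hT : 0 ≤ T)
    (hfc : ContinuousOn f (Icc 0 T)) (hf : ∀ t ∈ Icc 0 T, 0 ≤ f t) (hσ : 0 ≤ σ) {δ : ℝ}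
    (hδ : 0 < δ) : ∃ v, IsRegularizedSolution G f σ (q * σ) T δ v := by
  have hp := h.pos
  have hq : 0 < q := hp.trans_le h.le
  obtain ⟨M, hM⟩ : ∃ M, ∀ t ∈ Icc 0 T, f t ≤ M := by
    obtain ⟨M, hM⟩ := isCompact_Icc.bddAbove_image hfc
    exact ⟨M, fun t ht => hM (mem_image_of_mem f ht)⟩
  have hmax : ∀ x, δ ≤ max x δ := fun x => le_max_right _ _
  have hmax0 : ∀ x, 0 < max x δ := fun x => hδ.trans_le (hmax x)
  have hnum : ∀ t ∈ Icc 0 T, 0 ≤ f t + q * σ * δ := fun t ht =>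
    add_nonneg (hf t ht) (by positivity)
  have hG : ∀ t ∈ Icc 0 T, ∀ x, p * δ ≤ G t (max x δ) := fun t ht x =>
    (mul_le_mul_of_nonneg_left (hmax x) hp.le).trans (h.mul_le ht (hmax0 x).le)
  have hpδ : 0 < p * δ := mul_pos hp hδ
  set N := M + q * σ * δ
  obtain ⟨v, hv0, hvc, hvd⟩ := exists_solution_of_lipschitz_of_bounded (x₀ := δ)
    (Φ := fun t x => (f t + q * σ * δ) / G t (max x δ) - σ) (T := T)
    (L := N / (p * δ) + σ) (K := N * q / (p * δ) ^ 2) hT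
    (by
      intro t ht x y
      have hx := hpδ.trans_le (hG t ht x)
      have hy := hpδ.trans_le (hG t ht y)
      have hN : f t + q * σ * δ ≤ N := by simpa [N] using hM t ht
      have heq : (f t + q * σ * δ) / G t (max x δ) - σ - ((f t + q * σ * δ) / G t (max y δ) - σ)
          = (f t + q * σ * δ) * (G t (max y δ) - G t (max x δ))
            / (G t (max x δ) * G t (max y δ)) := by
        field_simp
        ring
      have h1 : |G t (max y δ) - G t (max x δ)| ≤ q * |x - y| := by
        refine (h.abs_sub_le ht (hmax0 y).le (hmax0 x).le).trans ?_
        refine mul_le_mul_of_nonneg_left ?_ hq.le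
        rw [abs_sub_comm x y]
        simpa using abs_max_sub_max_le_abs y x δ
      rw [heq, abs_div, abs_mul, abs_of_nonneg (hnum t ht), abs_of_pos (mul_pos hx hy)]
      calc (f t + q * σ * δ) * |G t (max y δ) - G t (max x δ)| / (G t (max x δ) * G t (max y δ))
          ≤ N * (q * |x - y|) / ((p * δ) * (p * δ)) := by
            have := (hnum t ht).trans hN
            gcongr
            · exact hG t ht x
            · exact hG t ht y
        _ = N * q / (p * δ) ^ 2 * |x - y| := by ring)
    (by
      intro x
      refine ((hfc.add continuousOn_const).div (h.cont _ (hmax0 x).le) fun t ht => ?_).sub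
        continuousOn_const
      exact (hpδ.trans_le (hG t ht x)).ne')
    (by
      intro t ht x
      have hx := hpδ.trans_le (hG t ht x)
      have hN : f t + q * σ * δ ≤ N := by simpa [N] using hM t ht
      have h1 : 0 ≤ (f t + q * σ * δ) / G t (max x δ) := div_nonneg (hnum t ht) hx.le
      have h2 : (f t + q * σ * δ) / G t (max x δ) ≤ N / (p * δ) :=
        div_le_div₀ ((hnum t ht).trans hN) hN hpδ (hG t ht x)
      rw [abs_le]
      constructor <;> linarith)
  have hge : ∀ t ∈ Icc 0 T, δ ≤ v t := by
    intro t ht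
    have := nonpos_of_deriv_nonpos_where_pos (d := fun t => δ - v t) (a := 0) (b := T)
      (continuousOn_const.sub hvc) (by simp [hv0]) (fun t ht hpos => ?_) t ht
    · linarith
    · refine ⟨_, (hvd t ht).const_sub δ, ?_⟩
      have htI := Ioo_subset_Icc_self ht
      have hvt : max (v t) δ = δ := max_eq_right (by linarith)
      have hGp := h.apply_pos htI hδ
      have : σ ≤ (f t + q * σ * δ) / G t δ := by
        rw [le_div_iff₀ hGp]
        have := mul_le_mul_of_nonneg_left (h.le_mul htI hδ.le) hσ
        have := hf t htI
        linarith
      simp only [hvt]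
      linarith
  refine ⟨v, hv0, hvc, hge, fun t ht => ?_⟩
  have := hvd t ht
  rwa [max_eq_left (hge t (Ioo_subset_Icc_self ht))] at this

namespace IsRegularizedSolution

variable {k δ δ' : ℝ} {v v' : ℝ → ℝ}

theorem mono (h : IsBiLipschitzFamily G (Icc 0 T) (Ici 0) p q)
    (hf : ∀ t ∈ Icc 0 T, 0 ≤ f t) (hk : 0 ≤ k) (hδ : 0 < δ) (hδδ' : δ ≤ δ')
    (hv : IsRegularizedSolution G f σ k T δ v) (hv' : IsRegularizedSolution G f σ k T δ' v') :
    ∀ t ∈ Icc 0 T, v t ≤ v' t := by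
  intro t ht
  refine sub_nonpos.1 (nonpos_of_deriv_nonpos_where_pos (d := fun t => v t - v' t)
    (hv.cont.sub hv'.cont) ?_ (fun t ht hpos => ?_) t ht)
  · rw [hv.zero, hv'.zero]
    exact sub_nonpos.2 hδδ'
  · refine ⟨_, (hv.deriv t ht).sub (hv'.deriv t ht), ?_⟩
    have htI := Ioo_subset_Icc_self ht
    have hv'0 : 0 < v' t := (hδ.trans_le hδδ').trans_le (hv'.ge t htI)
    have h1 : (f t + k * δ) / G t (v t) ≤ (f t + k * δ') / G t (v' t) :=
      div_le_div₀ (add_nonneg (hf t htI) (mul_nonneg hk (hδ.le.trans hδδ')))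
        (by gcongr) (h.apply_pos htI hv'0) (h.apply_mono htI hv'0.le (by linarith))
    linarith

theorem le_affine (h : IsBiLipschitzFamily G (Icc 0 T) (Ici 0) p q)
    (hσ : 0 ≤ σ) (hδ : 0 < δ) {A B C : ℝ} (hfC : ∀ t ∈ Icc 0 T, f t ≤ C * t)
    (hA : 1 ≤ A) (hB : 1 ≤ B) (hAk : k ≤ p * A) (hBC : C ≤ p * B)
    (hv : IsRegularizedSolution G f σ k T δ v) :
    ∀ t ∈ Icc 0 T, v t ≤ A * δ + B * t := by
  intro t ht
  refine sub_nonpos.1 (nonpos_of_deriv_nonpos_where_pos (d := fun t => v t - (A * δ + B * t))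
    (hv.cont.sub (by fun_prop)) ?_ (fun t ht hpos => ?_) t ht)
  · rw [hv.zero]
    nlinarith
  · refine ⟨_, (hv.deriv t ht).sub (((hasDerivAt_id t).const_mul B).const_add (A * δ)), ?_⟩
    have htI := Ioo_subset_Icc_self ht
    have ht0 := ht.1
    have hAB : 0 < A * δ + B * t := by positivity
    have h1 : (f t + k * δ) / G t (v t) ≤ B := by
      have hvt : 0 < v t := hδ.trans_le (hv.ge t htI)
      rw [div_le_iff₀ (h.apply_pos htI hvt)]
      have hp := h.pos
      have h2 : p * (A * δ + B * t) ≤ G t (v t) :=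
        (mul_le_mul_of_nonneg_left (by linarith) hp.le).trans (h.mul_le htI hvt.le)
      have h3 : p * (A * δ + B * t) ≤ B * G t (v t) := by
        have : 0 ≤ p * (A * δ + B * t) := by positivity
        nlinarith
      have h4 := hfC t htI
      have h5 := mul_le_mul_of_nonneg_right hAk hδ.le
      have h6 := mul_le_mul_of_nonneg_right hBC ht0.le
      linarith
    rw [mul_one]
    linarith

theorem exists_mul_sub_le (h : IsBiLipschitzFamily G (Icc 0 T) (Ici 0) p q) (hσ : 0 ≤ σ)
    (hk : 0 ≤ k) (hfc : ContinuousOn f (Icc 0 T)) (hf : ∀ t ∈ Ioc 0 T, 0 < f t) {s : ℝ}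
    (hs : s ∈ Ioo 0 T) :
    ∃ η > 0, ∀ δ > 0, ∀ v, IsRegularizedSolution G f σ k T δ v →
      ∀ t ∈ Icc s T, η * (t - s) ≤ v t := by
  have hT : 0 < T := hs.1.trans hs.2
  have hq : 0 < q := h.pos.trans_le h.le
  have hsub : Icc s T ⊆ Icc 0 T := Icc_subset_Icc_left hs.1.le
  obtain ⟨t₀, ht₀, hmin⟩ := isCompact_Icc.exists_isMinOn (nonempty_Icc.2 hs.2.le) (hfc.mono hsub)
  have hc : 0 < f t₀ := hf t₀ ⟨hs.1.trans_le ht₀.1, ht₀.2⟩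
  set c := f t₀
  set η := min 1 (c / (q * T * (1 + σ)))
  have hη : 0 < η := lt_min one_pos (by positivity)
  have hη1 : η ≤ 1 := min_le_left _ _
  have hηc : η * (q * T * (1 + σ)) ≤ c := by
    rw [← le_div_iff₀ (by positivity)]
    exact min_le_right _ _
  refine ⟨η, hη, fun δ hδ v hv t ht => ?_⟩
  refine sub_nonpos.1 (nonpos_of_deriv_nonpos_where_pos (d := fun t => η * (t - s) - v t)
    (ContinuousOn.sub (by fun_prop) (hv.cont.mono hsub)) ?_ (fun t ht hpos => ?_) t ht)
  · rw [sub_self, mul_zero, zero_sub]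
    exact neg_nonpos.2 (hδ.le.trans (hv.ge s ⟨hs.1.le, hs.2.le⟩))
  · have htI : t ∈ Icc 0 T := hsub (Ioo_subset_Icc_self ht)
    refine ⟨_, (((hasDerivAt_id t).sub_const s).const_mul η).sub
      (hv.deriv t ⟨hs.1.trans ht.1, ht.2⟩), ?_⟩
    have hvt : 0 < v t := hδ.trans_le (hv.ge t htI)
    have h1 : 1 + σ ≤ (f t + k * δ) / G t (v t) := by
      rw [le_div_iff₀ (h.apply_pos htI hvt)]
      have h2 : G t (v t) ≤ q * (η * T) := by
        refine (h.le_mul htI hvt.le).trans (mul_le_mul_of_nonneg_left ?_ hq.le)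
        have := mul_le_mul_of_nonneg_left (show t - s ≤ T by linarith [ht.2, hs.1]) hη.le
        linarith
      have h3 := mul_le_mul_of_nonneg_left h2 (show 0 ≤ 1 + σ by linarith)
      have h4 : c ≤ f t := hmin (Ioo_subset_Icc_self ht)
      have h5 : 0 ≤ k * δ := mul_nonneg hk hδ.le
      linarith
    rw [mul_one]
    linarith

end IsRegularizedSolution

/-- The singular problem `dV/dt = f / G(t, V) - σ`, `V(0) = 0` has a positive solution. -/
theorem IsBiLipschitzFamily.exists_pos_solution
    (h : IsBiLipschitzFamily G (Icc 0 T) (Ici 0) p q) (hT : 0 < T)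
    (hfc : ContinuousOn f (Icc 0 T)) (hf0 : 0 ≤ f 0) (hf : ∀ t ∈ Ioc 0 T, 0 < f t) (hσ : 0 ≤ σ)
    {C : ℝ} (hfC : ∀ t ∈ Icc 0 T, f t ≤ C * t) :
    ∃ (B : ℝ) (V : ℝ → ℝ), V 0 = 0 ∧ ContinuousOn V (Ico 0 T) ∧
      ∀ t ∈ Ioo 0 T, 0 < V t ∧ V t ≤ B * t ∧ HasDerivAt V (f t / G t (V t) - σ) t := by
  have hp := h.pos
  have hq : 0 < q := hp.trans_le h.le
  have hfnn : ∀ t ∈ Icc 0 T, 0 ≤ f t := by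
    intro t ht
    rcases ht.1.eq_or_lt with rfl | h0
    · exact hf0
    · exact (hf t ⟨h0, ht.2⟩).le
  obtain ⟨M, hM⟩ : ∃ M, ∀ t ∈ Icc 0 T, f t ≤ M := by
    obtain ⟨M, hM⟩ := isCompact_Icc.bddAbove_image hfc
    exact ⟨M, fun t ht => hM (mem_image_of_mem f ht)⟩
  set k := q * σ with hk_def
  have hk : 0 ≤ k := by positivity
  set δ : ℕ → ℝ := fun n => 1 / ((n : ℝ) + 1) with hδ_def
  have hδ : ∀ n, 0 < δ n := fun n => by positivity
  have hδ1 : ∀ n, δ n ≤ 1 := fun n => by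
    rw [hδ_def, div_le_one (by positivity)]
    simp
  have hδanti : Antitone δ := fun m n hmn => one_div_le_one_div_of_le (by positivity) (by gcongr)
  have hδlim : Tendsto δ atTop (𝓝 0) := tendsto_one_div_add_atTop_nhds_zero_nat
  choose v hv using fun n => h.exists_isRegularizedSolution hT.le hfc hfnn hσ (hδ n)
  set V : ℝ → ℝ := fun t => ⨅ n, v n t
  have hlim : ∀ t ∈ Icc 0 T, Tendsto (fun n => v n t) atTop (𝓝 (V t)) := fun t ht =>
    tendsto_atTop_ciInf
      (fun m n hmn => (hv n).mono h hfnn hk (hδ n) (hδanti hmn) (hv m) t ht)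
      ⟨0, by rintro _ ⟨n, rfl⟩; exact (hδ n).le.trans ((hv n).ge t ht)⟩
  have hVB : ∀ t ∈ Icc 0 T, V t ≤ max 1 (C / p) * t := by
    intro t ht
    have h1 : Tendsto (fun n => max 1 (k / p) * δ n + max 1 (C / p) * t) atTop
        (𝓝 (max 1 (k / p) * 0 + max 1 (C / p) * t)) :=
      (hδlim.const_mul _).add_const _
    have h2 := le_of_tendsto_of_tendsto' (hlim t ht) h1 fun n =>
      (hv n).le_affine h hσ (hδ n) hfC (le_max_left _ _) (le_max_left _ _)
        (by rw [← div_le_iff₀' hp]; exact le_max_right _ _)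
        (by rw [← div_le_iff₀' hp]; exact le_max_right _ _) t ht
    simpa using h2
  have hV0 : V 0 = 0 := by
    refine tendsto_nhds_unique (hlim 0 ⟨le_rfl, hT.le⟩) ?_
    simpa only [(hv _).zero] using hδlim
  have hmain : ∀ t ∈ Ioo 0 T, 0 < V t ∧ HasDerivAt V (f t / G t (V t) - σ) t := by
    intro t ht
    have ht0 := ht.1
    set a := 2 * t / 3 with ha_def
    obtain ⟨η, hη, hηv⟩ := IsRegularizedSolution.exists_mul_sub_le h hσ hk hfc hf
      (s := t / 3) ⟨by positivity, by linarith [ht.2]⟩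
    have hsub : Icc a T ⊆ Icc 0 T := Icc_subset_Icc_left (by positivity)
    set c := η * (t / 3)
    have hc : 0 < c := by positivity
    have hcv : ∀ n, ∀ x ∈ Icc a T, c ≤ v n x := fun n x hx =>
      (mul_le_mul_of_nonneg_left (by linarith [hx.1]) hη.le).trans
        (hηv (δ n) (hδ n) (v n) (hv n) x ⟨by linarith [hx.1], hx.2⟩)
    have hcV : ∀ x ∈ Icc a T, c ≤ V x := fun x hx =>
      ge_of_tendsto' (hlim x (hsub hx)) fun n => hcv n x hx
    have htI : t ∈ Ioo a T := ⟨by linarith, ht.2⟩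
    have hGpos : ∀ x ∈ Icc a T, ∀ y, c ≤ y → 0 < G x y := fun x hx y hy =>
      h.apply_pos (hsub hx) (hc.trans_le hy)
    have hGcont : ∀ w : ℝ → ℝ, ContinuousOn w (Icc a T) → (∀ x ∈ Icc a T, c ≤ w x) →
        ContinuousOn (fun x => G x (w x)) (Icc a T) := fun w hw hcw =>
      h.continuousOn_prod.comp (f := fun x => (x, w x)) (continuousOn_id.prodMk hw)
        fun x hx => ⟨hsub hx, hc.le.trans (hcw x hx)⟩
    have hvc : ∀ n, ContinuousOn (v n) (Icc a T) := fun n => (hv n).cont.mono hsub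
    have hvd : ∀ n, ∀ x ∈ Ioo a T,
        HasDerivAt (v n) ((f x + k * δ n) / G x (v n x) - σ) x := fun n x hx =>
      (hv n).deriv x ⟨(show 0 < a by positivity).trans hx.1, hx.2⟩
    have hbd : ∀ n, ∀ x ∈ Icc a T,
        |(f x + k * δ n) / G x (v n x) - σ| ≤ (M + k) / (p * c) + σ := by
      intro n x hx
      have hN0 : 0 ≤ f x + k * δ n := add_nonneg (hfnn x (hsub hx)) (mul_nonneg hk (hδ n).le)
      have hN : f x + k * δ n ≤ M + k :=
        add_le_add (hM x (hsub hx)) (mul_le_of_le_one_right hk (hδ1 n))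
      have hGc : p * c ≤ G x (v n x) :=
        (mul_le_mul_of_nonneg_left (hcv n x hx) hp.le).trans
          (h.mul_le (hsub hx) (hc.le.trans (hcv n x hx)))
      have h1 := div_nonneg hN0 (hGpos x hx _ (hcv n x hx)).le
      have h2 := div_le_div₀ (hN0.trans hN) hN (mul_pos hp hc) hGc
      rw [abs_le]
      constructor <;> linarith
    have hlim' : ∀ x ∈ Icc a T, Tendsto (fun n => v n x) atTop (𝓝 (V x)) := fun x hx =>
      hlim x (hsub hx)
    have hVc : ContinuousOn V (Icc a T) := continuousOn_of_tendsto_of_deriv_bound hvc hvd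
      (fun n x hx => hbd n x (Ioo_subset_Icc_self hx)) hlim'
    refine ⟨hc.trans_le (hcV t (Ioo_subset_Icc_self htI)), ?_⟩
    refine hasDerivAt_of_tendsto_of_deriv_bound (H := fun x => f x / G x (V x) - σ) hvc hvd
      (fun n => ?_) hbd hlim' (fun x hx => ?_) ?_ htI
    · exact (((hfc.mono hsub).add continuousOn_const).div (hGcont _ (hvc n) (hcv n))
        fun x hx => (hGpos x hx _ (hcv n x hx)).ne').sub continuousOn_const
    · have hGx : Tendsto (fun n => G x (v n x)) atTop (𝓝 (G x (V x))) := by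
        have h1 := h.continuousOn_prod (x, V x) ⟨hsub hx, hc.le.trans (hcV x hx)⟩
        refine h1.tendsto.comp (tendsto_nhdsWithin_iff.2
          ⟨tendsto_const_nhds.prodMk_nhds (hlim' x hx), Eventually.of_forall fun n => ?_⟩)
        exact ⟨hsub hx, hc.le.trans (hcv n x hx)⟩
      refine (Tendsto.div ?_ hGx (hGpos x hx _ (hcV x hx)).ne').sub_const σ
      simpa using (hδlim.const_mul k).const_add (f x)
    · exact ((hfc.mono hsub).div (hGcont _ hVc hcV)
        fun x hx => (hGpos x hx _ (hcV x hx)).ne').sub continuousOn_const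
  refine ⟨max 1 (C / p), V, hV0, fun t ht => ?_, fun t ht =>
    ⟨(hmain t ht).1, hVB t (Ioo_subset_Icc_self ht), (hmain t ht).2⟩⟩
  rcases ht.1.eq_or_lt with rfl | h0
  · have hsq : Tendsto V (𝓝[Ico 0 T] 0) (𝓝 0) := by
      refine tendsto_of_tendsto_of_tendsto_of_le_of_le' (g := fun _ => (0 : ℝ))
        (h := fun t => max 1 (C / p) * t) tendsto_const_nhds ?_ ?_ ?_
      · refine Tendsto.mono_left ?_ nhdsWithin_le_nhds
        have : Continuous fun t : ℝ => max 1 (C / p) * t := by fun_prop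
        simpa using this.tendsto 0
      · filter_upwards [self_mem_nhdsWithin] with x hx
        rcases hx.1.eq_or_lt with rfl | hx0
        · exact hV0.ge
        · exact (hmain x ⟨hx0, hx.2⟩).1.le
      · filter_upwards [self_mem_nhdsWithin] with x hx
        exact hVB x (Ico_subset_Icc_self hx)
    rwa [ContinuousWithinAt, hV0]
  · exact (hmain t ⟨h0, ht.2⟩).2.continuousAt.continuousWithinAt

end Regularized

namespace FluxData

variable (F : FluxData)

theorem mem_Omega_of_abs_le {u s r : ℝ} (hs : (u, s) ∈ OmegaSet F.ω) (hr : |r| ≤ |s|) :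
    (u, r) ∈ OmegaSet F.ω :=
  ⟨hs.1, (ENNReal.ofReal_le_ofReal hr).trans_lt hs.2⟩

theorem a_zero {u : ℝ} (hu : u ∈ Icc (0 : ℝ) 1) : F.a u 0 = 0 := by
  have h0 : (u, (0 : ℝ)) ∈ OmegaSet F.ω := ⟨hu, by simpa using F.ω_pos u hu⟩
  have := F.a_odd u 0 h0
  rw [neg_zero] at this
  linarith

theorem a_strictMonoOn (u : ℝ) : StrictMonoOn (F.a u) {s | (u, s) ∈ OmegaSet F.ω} := by
  have hconv : Convex ℝ {s | (u, s) ∈ OmegaSet F.ω} := by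
    refine Set.OrdConnected.convex ⟨fun x hx y hy z hz => ?_⟩
    rcases le_total |x| |y| with h | h
    · exact F.mem_Omega_of_abs_le hy ((abs_le_max_abs_abs hz.1 hz.2).trans (max_le h le_rfl))
    · exact F.mem_Omega_of_abs_le hx ((abs_le_max_abs_abs hz.1 hz.2).trans (max_le le_rfl h))
  refine strictMonoOn_of_deriv_pos hconv (fun s hs => ?_) fun s hs => ?_
  · obtain ⟨d, -, hd⟩ := F.a_deriv_pos u s hs
    exact hd.continuousAt.continuousWithinAt
  · have hs' := interior_subset hs
    obtain ⟨d, hd0, hd⟩ := F.a_deriv_pos u s hs'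
    rwa [hd.deriv]

theorem g_le_g {u v w : ℝ} (hv : (u, v) ∈ DSet F.aplus) (hw : (u, w) ∈ DSet F.aplus)
    (hvw : v ≤ w) : F.g u v ≤ F.g u w := by
  obtain ⟨hv1, hv2⟩ := F.g_spec _ hv
  obtain ⟨hw1, hw2⟩ := F.g_spec _ hw
  refine ((F.a_strictMonoOn u).le_iff_le hv1 hw1).1 ?_
  rw [hv2, hw2]
  exact hvw

theorem g_pos {u v : ℝ} (hv : (u, v) ∈ DSet F.aplus) (h0 : 0 < v) : 0 < F.g u v := by
  obtain ⟨hv1, hv2⟩ := F.g_spec _ hv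
  refine ((F.a_strictMonoOn u).lt_iff_lt (F.mem_Omega_of_abs_le hv1 (by simp)) hv1).1 ?_
  rw [hv2, F.a_zero hv.1]
  exact h0

theorem f_nonneg {u : ℝ} (hu : u ∈ Icc (0 : ℝ) 1) : 0 ≤ F.f u := by
  rcases hu.1.eq_or_lt with rfl | h0
  · exact F.f_zero.ge
  rcases hu.2.eq_or_lt with rfl | h1
  · exact F.f_one.ge
  exact (F.f_pos u ⟨h0, h1⟩).le

/-- `Ω` contains a box around `(1, 0)`. -/
theorem exists_box : ∃ r : ℝ, 0 < r ∧ r ≤ 1 ∧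
    ∀ u ∈ Icc (1 - r) 1, ∀ s ∈ Icc (-r) r, (u, s) ∈ OmegaSet F.ω := by
  obtain ⟨y, hy0, hy1⟩ := exists_between (F.ω_pos 1 ⟨zero_le_one, le_rfl⟩)
  have hy : y ≠ ⊤ := (hy1.trans_le le_top).ne
  have hlsc := F.ω_lsc 1 ⟨zero_le_one, le_rfl⟩ y hy1
  obtain ⟨e, he, hball⟩ := Metric.mem_nhdsWithin_iff.1 hlsc
  have hyr : 0 < y.toReal := ENNReal.toReal_pos hy0.ne' hy
  refine ⟨min 1 (min (e / 2) y.toReal), lt_min one_pos (lt_min (by positivity) hyr),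
    min_le_left _ _, fun u hu s hs => ?_⟩
  set r := min 1 (min (e / 2) y.toReal)
  have h1 : r ≤ 1 := min_le_left _ _
  have h2 : r ≤ e / 2 := (min_le_right _ _).trans (min_le_left _ _)
  have h3 : r ≤ y.toReal := (min_le_right _ _).trans (min_le_right _ _)
  have huI : u ∈ Icc (0 : ℝ) 1 := ⟨by linarith [hu.1], hu.2⟩
  refine ⟨huI, ?_⟩
  have hyu : y < F.ω u := hball ⟨by
    rw [Metric.mem_ball, Real.dist_eq, abs_lt]
    constructor <;> linarith [hu.1, hu.2], huI⟩
  refine lt_of_le_of_lt ?_ hyu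
  rw [ENNReal.ofReal_le_iff_le_toReal hy]
  exact (abs_le.2 hs).trans h3

/-- On a box around `(1, 0)` the flux is bi-Lipschitz in its second variable. -/
theorem exists_box_bounds : ∃ r m M : ℝ, 0 < r ∧ r ≤ 1 ∧ 0 < m ∧ m ≤ M ∧
    (∀ u ∈ Icc (1 - r) 1, ∀ s ∈ Icc (-r) r, (u, s) ∈ OmegaSet F.ω) ∧
    ∀ u ∈ Icc (1 - r) 1, ∀ s ∈ Icc (-r) r, ∀ t ∈ Icc (-r) r, s ≤ t →
      m * (t - s) ≤ F.a u t - F.a u s ∧ F.a u t - F.a u s ≤ M * (t - s) := by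
  obtain ⟨r, hr, hr1, hbox⟩ := F.exists_box
  set A : ℝ × ℝ → ℝ := fun z => F.a z.1 z.2
  set Q : Set (ℝ × ℝ) := Icc (1 - r) 1 ×ˢ Icc (-r) r
  have hQ : Q ⊆ OmegaSet F.ω := fun z hz => hbox z.1 hz.1 z.2 hz.2
  have hud : UniqueDiffOn ℝ Q :=
    (uniqueDiffOn_Icc (by linarith)).prod (uniqueDiffOn_Icc (by linarith))
  have hAC : ContDiffOn ℝ 1 A Q := F.a_C1.mono hQ
  set D : ℝ × ℝ → ℝ := fun z => fderivWithin ℝ A Q z (0, 1)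
  have hDc : ContinuousOn D Q :=
    (hAC.continuousOn_fderivWithin hud le_rfl).clm_apply continuousOn_const
  have hQc : IsCompact Q := isCompact_Icc.prod isCompact_Icc
  have hQne : Q.Nonempty := ⟨(1, 0), ⟨by linarith, le_rfl⟩, by linarith, hr.le⟩
  have hder : ∀ u ∈ Icc (1 - r) 1, ∀ s ∈ Icc (-r) r,
      HasDerivAt (F.a u) (D (u, s)) s ∧ 0 < D (u, s) := by
    intro u hu s hs
    obtain ⟨d, hd0, hd⟩ := F.a_deriv_pos u s (hbox u hu s hs)
    have h1 : HasFDerivWithinAt A (fderivWithin ℝ A Q (u, s)) Q (u, s) :=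
      ((hAC.differentiableOn one_ne_zero) (u, s) ⟨hu, hs⟩).hasFDerivWithinAt
    have h2 : HasDerivWithinAt (fun s : ℝ => (u, s)) ((0 : ℝ), (1 : ℝ)) (Icc (-r) r) s :=
      (hasDerivWithinAt_const s _ u).prodMk (hasDerivWithinAt_id s _)
    have h3 : HasDerivWithinAt (F.a u) (D (u, s)) (Icc (-r) r) s :=
      h1.comp_hasDerivWithinAt s h2 fun x hx => ⟨hu, hx⟩
    have h4 : D (u, s) = d :=
      (uniqueDiffOn_Icc (by linarith) s hs).eq_deriv _ h3 hd.hasDerivWithinAt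
    rw [h4]
    exact ⟨hd, hd0⟩
  obtain ⟨z₀, hz₀, hmin⟩ := hQc.exists_isMinOn hQne hDc
  obtain ⟨z₁, hz₁, hmax⟩ := hQc.exists_isMaxOn hQne hDc
  refine ⟨r, D z₀, D z₁, hr, hr1, (hder z₀.1 hz₀.1 z₀.2 hz₀.2).2, hmin hz₁, hbox,
    fun u hu s hs t ht hst => ⟨?_, ?_⟩⟩
  · refine (convex_Icc (-r) r).mul_sub_le_image_sub_of_le_deriv
      (fun x hx => (hder u hu x hx).1.continuousAt.continuousWithinAt)
      (fun x hx => ((hder u hu x (interior_subset hx)).1).differentiableAt.differentiableWithinAt)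
      (fun x hx => ?_) s hs t ht hst
    rw [(hder u hu x (interior_subset hx)).1.deriv]
    exact hmin (show (u, x) ∈ Q from ⟨hu, interior_subset hx⟩)
  · refine (convex_Icc (-r) r).image_sub_le_mul_sub_of_deriv_le
      (fun x hx => (hder u hu x hx).1.continuousAt.continuousWithinAt)
      (fun x hx => ((hder u hu x (interior_subset hx)).1).differentiableAt.differentiableWithinAt)
      (fun x hx => ?_) s hs t ht hst
    rw [(hder u hu x (interior_subset hx)).1.deriv]
    exact hmax (show (u, x) ∈ Q from ⟨hu, interior_subset hx⟩)

/-- Near `(1, 0)` the partial inverse `g` is a bi-Lipschitz family. -/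
theorem exists_isBiLipschitzFamily_g : ∃ T v₀ p q : ℝ, 0 < T ∧ T ≤ 1 ∧ 0 < v₀ ∧
    (∀ t ∈ Icc 0 T, ∀ v ∈ Icc 0 v₀, (1 - t, v) ∈ DSet F.aplus) ∧
    IsBiLipschitzFamily (fun t v => F.g (1 - t) v) (Icc 0 T) (Icc 0 v₀) p q := by
  obtain ⟨r, m, M, hr, hr1, hm, hmM, hbox, hbd⟩ := F.exists_box_bounds
  have hM : 0 < M := hm.trans_le hmM
  have hu : ∀ t ∈ Icc 0 r, 1 - t ∈ Icc (1 - r) 1 := fun t ht =>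
    ⟨by linarith [ht.2], by linarith [ht.1]⟩
  have hu' : ∀ t ∈ Icc 0 r, 1 - t ∈ Icc (0 : ℝ) 1 := fun t ht =>
    ⟨by linarith [ht.2], by linarith [ht.1]⟩
  have h0r : (0 : ℝ) ∈ Icc (-r) r := ⟨by linarith, hr.le⟩
  have hrr : r ∈ Icc (-r) r := ⟨by linarith, le_rfl⟩
  have har : ∀ t ∈ Icc 0 r, m * r ≤ F.a (1 - t) r := by
    intro t ht
    have := (hbd _ (hu t ht) 0 h0r r hrr hr.le).1
    rw [F.a_zero (hu' t ht)] at this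
    linarith
  set v₀ := m * r / 2 with hv₀_def
  have hmr : 0 < m * r := mul_pos hm hr
  have hv₀ : 0 < v₀ := by positivity
  have hD : ∀ t ∈ Icc 0 r, ∀ v ∈ Icc 0 v₀, (1 - t, v) ∈ DSet F.aplus := by
    intro t ht v hv
    refine ⟨hu' t ht, ?_⟩
    change ENNReal.ofReal |v| < F.aplus (1 - t)
    rw [abs_of_nonneg hv.1, F.aplus_def _ (hu' t ht)]
    refine lt_of_lt_of_le ?_ (le_biSup (fun s => ENNReal.ofReal (F.a (1 - t) s))
      (show r ∈ {s : ℝ | 0 < s ∧ (1 - t, s) ∈ OmegaSet F.ω} from ⟨hr, hbox _ (hu t ht) r hrr⟩))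
    exact (ENNReal.ofReal_lt_ofReal_iff (hmr.trans_le (har t ht))).2
      (by linarith [hv.2, har t ht])
  have hg : ∀ t ∈ Icc 0 r, ∀ v ∈ Icc 0 v₀,
      F.g (1 - t) v ∈ Icc (-r) r ∧ F.a (1 - t) (F.g (1 - t) v) = v := by
    intro t ht v hv
    obtain ⟨h1, h2⟩ := F.g_spec _ (hD t ht v hv)
    have hmono := F.a_strictMonoOn (1 - t)
    refine ⟨⟨?_, ?_⟩, h2⟩
    · have : (0 : ℝ) ≤ F.g (1 - t) v := by
        refine (hmono.le_iff_le (hbox _ (hu t ht) 0 h0r) h1).1 ?_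
        rw [h2, F.a_zero (hu' t ht)]
        exact hv.1
      linarith
    · refine (hmono.le_iff_le h1 (hbox _ (hu t ht) r hrr)).1 ?_
      rw [h2]
      linarith [hv.2, har t ht]
  have hgmono : ∀ t ∈ Icc 0 r, ∀ v ∈ Icc 0 v₀, ∀ w ∈ Icc 0 v₀, v ≤ w →
      F.g (1 - t) v ≤ F.g (1 - t) w := fun t ht v hv w hw hvw =>
    F.g_le_g (hD t ht v hv) (hD t ht w hw) hvw
  refine ⟨r, v₀, 1 / M, 1 / m, hr, hr1, hv₀, hD, by positivity,
    one_div_le_one_div_of_le hm hmM, fun t ht => ?_, fun v hv => ?_, fun t ht v hv w hw hvw => ?_,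
    fun t ht v hv w hw hvw => ?_⟩
  · obtain ⟨h1, h2⟩ := F.g_spec _ (hD t ht 0 ⟨le_rfl, hv₀.le⟩)
    refine (F.a_strictMonoOn (1 - t)).injOn h1 (hbox _ (hu t ht) 0 h0r) ?_
    rw [h2, F.a_zero (hu' t ht)]
  · have hAc : ContinuousOn (fun z : ℝ × ℝ => F.a z.1 z.2) (OmegaSet F.ω) := F.a_C1.continuousOn
    intro t ht
    have hlim : Tendsto (fun x => |v - F.a (1 - x) (F.g (1 - t) v)| / m) (𝓝[Icc 0 r] t) (𝓝 0) := by
      have h1 : ContinuousOn (fun x => F.a (1 - x) (F.g (1 - t) v)) (Icc 0 r) :=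
        hAc.comp (f := fun x => (1 - x, F.g (1 - t) v)) (by fun_prop)
          fun x hx => hbox _ (hu x hx) _ (hg t ht v hv).1
      have h2 := ((h1 t ht).tendsto.const_sub v).abs.div_const m
      rwa [(hg t ht v hv).2, sub_self, abs_zero, zero_div] at h2
    rw [ContinuousWithinAt, tendsto_iff_dist_tendsto_zero]
    refine squeeze_zero' (Eventually.of_forall fun _ => dist_nonneg) ?_ hlim
    filter_upwards [self_mem_nhdsWithin] with x hx
    obtain ⟨hgx, hax⟩ := hg x hx v hv
    obtain ⟨hgt, -⟩ := hg t ht v hv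
    rw [Real.dist_eq, le_div_iff₀' hm]
    rcases le_total (F.g (1 - x) v) (F.g (1 - t) v) with hle | hle
    · have h1 := (hbd _ (hu x hx) _ hgx _ hgt hle).1
      rw [hax] at h1
      rw [abs_sub_comm, abs_of_nonneg (sub_nonneg.2 hle), abs_sub_comm]
      exact h1.trans (le_abs_self _)
    · have h1 := (hbd _ (hu x hx) _ hgt _ hgx hle).1
      rw [hax] at h1
      rw [abs_of_nonneg (sub_nonneg.2 hle)]
      exact h1.trans (le_abs_self _)
  · have h1 := (hbd _ (hu t ht) _ (hg t ht v hv).1 _ (hg t ht w hw).1 (hgmono t ht v hv w hw hvw)).2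
    rw [(hg t ht v hv).2, (hg t ht w hw).2] at h1
    rw [one_div, inv_mul_le_iff₀ hM]
    exact h1
  · have h1 := (hbd _ (hu t ht) _ (hg t ht v hv).1 _ (hg t ht w hw).1 (hgmono t ht v hv w hw hvw)).1
    rw [(hg t ht v hv).2, (hg t ht w hw).2] at h1
    rw [one_div, le_inv_mul_iff₀ hm]
    exact h1

theorem exists_f_le_mul : ∃ C : ℝ, ∀ t ∈ Icc (0 : ℝ) 1, F.f (1 - t) ≤ C * t := by
  obtain ⟨K, hK⟩ := F.f_C1.exists_lipschitzOnWith one_ne_zero (convex_Icc 0 1) isCompact_Icc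
  refine ⟨K, fun t ht => ?_⟩
  have := hK.dist_le_mul (1 - t) ⟨by linarith [ht.2], by linarith [ht.1]⟩ 1 ⟨zero_le_one, le_rfl⟩
  rw [Real.dist_eq, Real.dist_eq, F.f_one, sub_zero, sub_sub_cancel_left, abs_neg,
    abs_of_nonneg ht.1] at this
  exact (le_abs_self _).trans this

theorem exists_isRightSolution {σ : ℝ} (hσ : 0 ≤ σ) : ∃ α V, IsRightSolution F σ α V := by
  obtain ⟨T, v₀, p, q, hT, hT1, hv₀, hD, hg⟩ := F.exists_isBiLipschitzFamily_g
  obtain ⟨C, hC⟩ := F.exists_f_le_mul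
  have hmaps : ∀ t ∈ Icc 0 (T / 2), 1 - t ∈ Icc (0 : ℝ) 1 := fun t ht =>
    ⟨by linarith [ht.2], by linarith [ht.1]⟩
  obtain ⟨B, W, hW0, hWc, hW⟩ := ((hg.extend hv₀.le).mono_left
    (Icc_subset_Icc_right (by linarith : T / 2 ≤ T))).exists_pos_solution
    (f := fun t => F.f (1 - t)) (by positivity)
    (F.f_C1.continuousOn.comp (f := fun t => 1 - t) (by fun_prop) hmaps)
    (by simp [F.f_one]) (fun t ht => F.f_pos _ ⟨by linarith [ht.2], by linarith [ht.1]⟩) hσ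
    (fun t ht => hC t ⟨ht.1, by linarith [ht.2]⟩)
  set T' := min (T / 2) (v₀ / max 1 B)
  have hB : 0 < max 1 B := one_pos.trans_le (le_max_left _ _)
  have hT' : 0 < T' := lt_min (by positivity) (by positivity)
  have hT'T : T' ≤ T / 2 := min_le_left _ _
  have hT'v : max 1 B * T' ≤ v₀ := by
    rw [← le_div_iff₀' hB]
    exact min_le_right _ _
  refine ⟨1 - T', fun u => W (1 - u), ⟨by linarith, by linarith⟩, ?_, by simpa using hW0, ?_⟩
  · exact hWc.comp (f := fun u => 1 - u) (by fun_prop) fun u hu =>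
      ⟨by linarith [hu.2], by linarith [hu.1]⟩
  · intro u hu
    obtain ⟨h1, h2, h3⟩ := hW (1 - u) ⟨by linarith [hu.2], by linarith [hu.1]⟩
    have hle : W (1 - u) ≤ v₀ := by
      have h4 : B * (1 - u) ≤ max 1 B * T' :=
        mul_le_mul (le_max_right _ _) (by linarith [hu.1]) (by linarith [hu.2]) hB.le
      linarith
    have hmem := hD (1 - u) ⟨by linarith [hu.2], by linarith [hu.1]⟩ _ ⟨h1.le, hle⟩
    rw [sub_sub_cancel] at hmem
    refine ⟨h1, hmem, ?_⟩
    simp only [min_eq_left hle, sub_self, mul_zero, add_zero, sub_sub_cancel] at h3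
    exact (h3.comp u ((hasDerivAt_id u).const_sub 1)).congr_deriv (by ring)

end FluxData

theorem IsRightSolution.le {F : FluxData} {σ ε : ℝ} {V₁ V₂ : ℝ → ℝ}
    (h₁ : IsRightSolution F σ ε V₁) (h₂ : IsRightSolution F σ ε V₂) {u : ℝ} (hu : u ∈ Ioc ε 1) :
    V₁ u ≤ V₂ u := by
  obtain ⟨hε, hc₁, h1₁, hV₁⟩ := h₁
  obtain ⟨-, hc₂, h1₂, hV₂⟩ := h₂
  have hmaps : ∀ t ∈ Icc 0 (1 - u), 1 - t ∈ Ioc ε 1 := fun t ht =>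
    ⟨by linarith [ht.2, hu.1], by linarith [ht.1]⟩
  have key := nonpos_of_deriv_nonpos_where_pos (d := fun t => V₁ (1 - t) - V₂ (1 - t))
    (a := 0) (b := 1 - u)
    ((hc₁.comp (f := fun t => 1 - t) (by fun_prop) hmaps).sub
      (hc₂.comp (f := fun t => 1 - t) (by fun_prop) hmaps))
    (by simp [h1₁, h1₂]) (fun t ht hpos => ?_) (1 - u) ⟨by linarith [hu.2], le_rfl⟩
  · simpa using key
  · have htI : 1 - t ∈ Ioo ε 1 := ⟨by linarith [ht.2, hu.1], by linarith [ht.1]⟩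
    obtain ⟨-, hm₁, hd₁⟩ := hV₁ _ htI
    obtain ⟨hp₂, hm₂, hd₂⟩ := hV₂ _ htI
    have hs : HasDerivAt (fun t : ℝ => 1 - t) (-1) t := (hasDerivAt_id t).const_sub 1
    refine ⟨_, (hd₁.comp t hs).sub (hd₂.comp t hs), ?_⟩
    have := div_le_div_of_nonneg_left (F.f_nonneg hm₁.1) (F.g_pos hm₂ hp₂)
      (F.g_le_g hm₂ hm₁ (by linarith))
    linarith

theorem stmt1 (F : FluxData) (σ : ℝ) (hσ : 0 ≤ σ) :
    (∃ α : ℝ, ∃ V : ℝ → ℝ, IsRightSolution F σ α V) ∧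
    (∀ ε : ℝ, ε ∈ Set.Ico (0:ℝ) 1 → ∀ V₁ V₂ : ℝ → ℝ,
      IsRightSolution F σ ε V₁ → IsRightSolution F σ ε V₂ →
      ∀ u ∈ Set.Ioc ε 1, V₁ u = V₂ u) := by
  exact ⟨F.exists_isRightSolution hσ, fun ε _ V₁ V₂ h₁ h₂ u hu =>
    le_antisymm (h₁.le h₂ hu) (h₂.le h₁ hu)⟩
end
end
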